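/- arXiv:2511.01722 — 5 statements merged into one kernel-verified Lean document; each statement's English description precedes it below -/
import Mathlib

section
/- Assume there exist a real number t ≠ 0 and a pair (a,b) ∈ ℝ²∖{(0,0)} such that β_r = t·a^(m−r)·b^r for all r = 0,…,m (equivalently P(x) = t·∏_{j=1}^m (a + b x_j); in particular a + b x ≠ 0 for all x ∈ I_j). Then (A₁,…,A_m) is extremal if and only if there exists a single real polynomial Υ of degree at most m such that for every j = 1,…,m and every x ∈ I_j one has (a+bx)^(m+3) · d²/dx² [ A_j(x) / (a+bx)^(m+1) ] = Υ(x). -/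
noncomputable section

/-- The `r`-th elementary symmetric function of the values of `x` over the finite set `s`. -/
def esymmOn {n : ℕ} (s : Finset (Fin n)) (x : Fin n → ℝ) (r : ℕ) : ℝ :=
  ∑ t ∈ s.powersetCard r, ∏ i ∈ t, x i

/-- `σ_r(x₁,…,x_n)`, the `r`-th elementary symmetric polynomial of `x₁,…,x_n`. -/
def esymm {n : ℕ} (x : Fin n → ℝ) (r : ℕ) : ℝ :=
  esymmOn Finset.univ x r

/-- `σ_r(x̂_j)`, the `r`-th elementary symmetric polynomial of the `n - 1` numbers
`x_i`, `i ≠ j`. -/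
def esymmHat {n : ℕ} (x : Fin n → ℝ) (j : Fin n) (r : ℕ) : ℝ :=
  esymmOn (Finset.univ.erase j) x r

/-- `Δ_j(x) = ∏_{i ≠ j} (x_j - x_i)` (an empty product being `1`). -/
def Delta {n : ℕ} (x : Fin n → ℝ) (j : Fin n) : ℝ :=
  ∏ i ∈ Finset.univ.erase j, (x j - x i)

/-- `P(x) = β₀ + ∑_{r=1}^m β_r σ_r(x) = ∑_{r=0}^m β_r σ_r(x)` (recall `σ₀ = 1`). -/
def Pfun (m : ℕ) (β : ℕ → ℝ) (x : Fin m → ℝ) : ℝ :=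
  ∑ r ∈ Finset.range (m + 1), β r * esymm x r

/-- `∂P/∂x_j = ∑_{r=1}^m β_r σ_{r-1}(x̂_j)`. -/
def dPfun (m : ℕ) (β : ℕ → ℝ) (x : Fin m → ℝ) (j : Fin m) : ℝ :=
  ∑ r ∈ Finset.range m, β (r + 1) * esymmHat x j r

/-- The extremality equation of the twisted orthotoric geometry (the separable Kähler
geometry associated with the Veronese factorization structure), with denominators cleared:
there are reals `α₀, α₁, …, α_m` such that for all `x ∈ Ω = I₁ × ⋯ × I_m`,
`∑_j [P² A_j'' − 2(m+1) P (∂P/∂x_j) A_j' + (m+1)(m+2) (∂P/∂x_j)² A_j] / Δ_j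
  = α₀ + ∑_r α_r σ_r(x)`. -/
def IsExtremalV (m : ℕ) (β : ℕ → ℝ) (I : Fin m → Set ℝ) (A : Fin m → ℝ → ℝ) : Prop :=
  ∃ α : ℕ → ℝ, ∀ x : Fin m → ℝ, (∀ j, x j ∈ I j) →
    (∑ j : Fin m,
      ((Pfun m β x) ^ 2 * deriv (deriv (A j)) (x j)
        - 2 * ((m : ℝ) + 1) * Pfun m β x * dPfun m β x j * deriv (A j) (x j)
        + ((m : ℝ) + 1) * ((m : ℝ) + 2) * (dPfun m β x j) ^ 2 * A j (x j)) / Delta x j)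
    = ∑ r ∈ Finset.range (m + 1), α r * esymm x r

/-- Expansion of `∏ (u + v x_i)` in elementary symmetric functions, in any `ℝ`-algebra. -/
theorem prod_add_mul_eq_sum_esymmOn {R : Type*} [CommRing R] [Algebra ℝ R] {n : ℕ}
    (s : Finset (Fin n)) (x : Fin n → ℝ) (u v : R) :
    ∏ i ∈ s, (u + v * algebraMap ℝ R (x i)) =
      ∑ r ∈ Finset.range (s.card + 1),
        u ^ (s.card - r) * v ^ r * algebraMap ℝ R (esymmOn s x r) := by
  simp_rw [add_comm u]
  rw [Finset.prod_add, Finset.sum_powerset]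
  refine Finset.sum_congr rfl fun r _ => ?_
  rw [esymmOn, map_sum, Finset.mul_sum]
  refine Finset.sum_congr rfl fun t ht => ?_
  obtain ⟨hts, rfl⟩ := Finset.mem_powersetCard.1 ht
  rw [Finset.prod_mul_distrib, Finset.prod_const, Finset.prod_const,
    Finset.card_sdiff_of_subset hts, map_prod]
  ring

theorem Pfun_eq_prod {m : ℕ} {β : ℕ → ℝ} {t a b : ℝ}
    (hβ : ∀ r ≤ m, β r = t * a ^ (m - r) * b ^ r) (x : Fin m → ℝ) :
    Pfun m β x = t * ∏ i, (a + b * x i) := by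
  have h := prod_add_mul_eq_sum_esymmOn Finset.univ x a b
  simp only [Algebra.algebraMap_self, RingHom.id_apply, Finset.card_univ, Fintype.card_fin] at h
  rw [h, Pfun, Finset.mul_sum]
  refine Finset.sum_congr rfl fun r hr => ?_
  rw [hβ r (Nat.lt_succ_iff.1 (Finset.mem_range.1 hr)), esymm]
  ring

theorem dPfun_eq_prod {m : ℕ} {β : ℕ → ℝ} {t a b : ℝ}
    (hβ : ∀ r ≤ m, β r = t * a ^ (m - r) * b ^ r) (x : Fin m → ℝ) (j : Fin m) :
    dPfun m β x j = t * b * ∏ i ∈ Finset.univ.erase j, (a + b * x i) := by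
  have h := prod_add_mul_eq_sum_esymmOn (Finset.univ.erase j) x a b
  have hm : 0 < m := j.pos
  simp only [Algebra.algebraMap_self, RingHom.id_apply, Finset.card_erase_of_mem,
    Finset.mem_univ, Finset.card_univ, Fintype.card_fin, Nat.sub_add_cancel hm] at h
  rw [h, dPfun, Finset.mul_sum]
  refine Finset.sum_congr rfl fun r hr => ?_
  have hr := Finset.mem_range.1 hr
  rw [hβ (r + 1) hr, esymmHat, show m - (r + 1) = m - 1 - r by omega]
  ring

/-- The operator `(a+bx)² f'' - 2(m+1)b(a+bx) f' + (m+1)(m+2)b² f`, which equals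
`(a+bx)^(m+3) (f/(a+bx)^(m+1))''` for smooth `f`. -/
def twistedOp (m : ℕ) (a b : ℝ) (f : ℝ → ℝ) (x : ℝ) : ℝ :=
  (a + b * x) ^ 2 * deriv (deriv f) x
    - 2 * ((m : ℝ) + 1) * b * (a + b * x) * deriv f x
    + ((m : ℝ) + 1) * ((m : ℝ) + 2) * b ^ 2 * f x

theorem HasDerivAt.div_affine_pow {f : ℝ → ℝ} {f' a b x : ℝ} (n : ℕ)
    (hf : HasDerivAt f f' x) (hx : a + b * x ≠ 0) :
    HasDerivAt (fun y => f y / (a + b * y) ^ n)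
      (f' / (a + b * x) ^ n - n * b * (f x / (a + b * x) ^ (n + 1))) x := by
  have hl : HasDerivAt (fun y : ℝ => a + b * y) b x := by
    simpa using ((hasDerivAt_id x).const_mul b).const_add a
  convert! hf.div (hl.pow n) (pow_ne_zero n hx) using 1
  rcases n with _ | n
  · simp
  · simp only [Nat.add_sub_cancel, Pi.pow_apply]
    field_simp
    ring

theorem mul_deriv_deriv_div_affine_pow {m : ℕ} {a b : ℝ} {f : ℝ → ℝ} {s : Set ℝ}
    (hs : IsOpen s) (hf : ContDiffOn ℝ (⊤ : ℕ∞) f s) (hnz : ∀ x ∈ s, a + b * x ≠ 0)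
    {x : ℝ} (hx : x ∈ s) :
    (a + b * x) ^ (m + 3) * deriv (deriv (fun y => f y / (a + b * y) ^ (m + 1))) x
      = twistedOp m a b f x := by
  have hd : ∀ y ∈ s, HasDerivAt f (deriv f y) y := fun y hy =>
    ((hf.differentiableOn (by simp)).differentiableAt (hs.mem_nhds hy)).hasDerivAt
  have hd2 : HasDerivAt (deriv f) (deriv (deriv f) x) x :=
    (((hf.deriv_of_isOpen (m := 1) hs (by norm_cast)).differentiableOn
      (by simp)).differentiableAt (hs.mem_nhds hx)).hasDerivAt
  have hev : deriv (fun y => f y / (a + b * y) ^ (m + 1)) =ᶠ[nhds x] fun y =>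
      deriv f y / (a + b * y) ^ (m + 1)
        - ((m + 1 : ℕ) : ℝ) * b * (f y / (a + b * y) ^ (m + 2)) := by
    filter_upwards [hs.mem_nhds hx] with y hy
    exact ((hd y hy).div_affine_pow (m + 1) (hnz y hy)).deriv
  have h := (hd2.div_affine_pow (m + 1) (hnz x hx)).sub
    (((hd x hx).div_affine_pow (m + 2) (hnz x hx)).const_mul (((m + 1 : ℕ) : ℝ) * b))
  rw [hev.deriv_eq]
  refine (congrArg _ h.deriv).trans ?_
  have := hnz x hx
  rw [twistedOp]
  push_cast
  field_simp
  ring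

/-- In the product case the extremality equation involves only `twistedOp` applied to each
`A j`. -/
theorem extremal_term_eq {m : ℕ} {β : ℕ → ℝ} {t a b : ℝ}
    (hβ : ∀ r ≤ m, β r = t * a ^ (m - r) * b ^ r) (f : ℝ → ℝ) (x : Fin m → ℝ) (j : Fin m) :
    (Pfun m β x) ^ 2 * deriv (deriv f) (x j)
        - 2 * ((m : ℝ) + 1) * Pfun m β x * dPfun m β x j * deriv f (x j)
        + ((m : ℝ) + 1) * ((m : ℝ) + 2) * (dPfun m β x j) ^ 2 * f (x j)
      = t ^ 2 * (∏ i ∈ Finset.univ.erase j, (a + b * x i)) ^ 2 * twistedOp m a b f (x j) := by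
  rw [Pfun_eq_prod hβ, dPfun_eq_prod hβ, ← Finset.mul_prod_erase _ _ (Finset.mem_univ j),
    twistedOp]
  ring

section

open Polynomial

/-- `∑_j q(u_j) / ∏_{i≠j} (u_j - u_i)` for `q` of degree at most the number of nodes. -/
theorem sum_eval_div_prod_sub {ι F : Type*} [Field F] [DecidableEq ι] {s : Finset ι}
    (hs : s.Nonempty) {u : ι → F} (hu : Set.InjOn u s) {q : F[X]} (hq : q.natDegree ≤ s.card) :
    ∑ j ∈ s, q.eval (u j) / ∏ i ∈ s.erase j, (u j - u i)
      = q.coeff (s.card - 1) + q.coeff s.card * ∑ j ∈ s, u j := by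
  set p := q - C (q.coeff s.card) * Lagrange.nodal s u with hp
  have hdeg : p.degree < s.card := by
    rw [degree_lt_iff_coeff_zero]
    intro k hk
    rcases hk.eq_or_lt with rfl | hk
    · have h1 := (Lagrange.nodal_monic (s := s) (v := u)).coeff_natDegree
      rw [Lagrange.natDegree_nodal] at h1
      simp [hp, h1]
    · rw [hp, coeff_sub, coeff_C_mul, coeff_eq_zero_of_natDegree_lt (hq.trans_lt hk),
        coeff_eq_zero_of_natDegree_lt (p := Lagrange.nodal s u)
          (by rwa [Lagrange.natDegree_nodal])]
      ring
  have h := Lagrange.coeff_eq_sum hu hdeg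
  rw [hp, coeff_sub, coeff_C_mul, Lagrange.nodal_eq,
    prod_X_sub_C_coeff_card_pred s u hs.card_pos, ← Lagrange.nodal_eq] at h
  rw [← sub_neg_eq_add, ← mul_neg, h]
  refine Finset.sum_congr rfl fun j hj => ?_
  simp [Lagrange.eval_nodal_at_node hj]

/-- A polynomial of degree at most `m`, read in the projective coordinate
`u = (a x - b) / (a + b x)`. -/
theorem exists_projective_change {m : ℕ} {a b : ℝ} (hab : a ^ 2 + b ^ 2 ≠ 0) {p : ℝ[X]}
    (hp : p.natDegree ≤ m) :
    ∃ q : ℝ[X], q.natDegree ≤ m ∧ ∀ x, a + b * x ≠ 0 →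
      p.eval x = (a + b * x) ^ m * q.eval ((a * x - b) / (a + b * x)) := by
  refine ⟨∑ k ∈ Finset.range (m + 1), C (p.coeff k / (a ^ 2 + b ^ 2) ^ m) *
    ((C a * X + C b) ^ k * (C (-b) * X + C a) ^ (m - k)), ?_, fun x hx => ?_⟩
  · refine natDegree_sum_le_of_forall_le _ _ fun k hk => ?_
    have hk := Nat.lt_succ_iff.1 (Finset.mem_range.1 hk)
    refine (natDegree_C_mul_le _ _).trans (natDegree_mul_le.trans ?_)
    have h1 : ((C a * X + C b) ^ k).natDegree ≤ k * 1 :=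
      natDegree_pow_le_of_le k natDegree_linear_le
    have h2 : ((C (-b) * X + C a) ^ (m - k)).natDegree ≤ (m - k) * 1 :=
      natDegree_pow_le_of_le (m - k) natDegree_linear_le
    omega
  · rw [eval_eq_sum_range' (Nat.lt_succ_of_le hp), eval_finsetSum, Finset.mul_sum]
    refine Finset.sum_congr rfl fun k hk => ?_
    have hk := Nat.lt_succ_iff.1 (Finset.mem_range.1 hk)
    have h1 : a * ((a * x - b) / (a + b * x)) + b = (a ^ 2 + b ^ 2) * x / (a + b * x) := by
      rw [mul_div_assoc', div_add' _ _ _ hx]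
      ring
    have h2 : -b * ((a * x - b) / (a + b * x)) + a = (a ^ 2 + b ^ 2) / (a + b * x) := by
      rw [mul_div_assoc', div_add' _ _ _ hx]
      ring
    simp only [eval_mul, eval_pow, eval_add, eval_C, eval_X, h1, h2]
    obtain ⟨l, rfl⟩ := Nat.exists_eq_add_of_le hk
    rw [Nat.add_sub_cancel_left, div_pow, div_pow, mul_pow, pow_add, pow_add]
    field_simp

/-- The first variation of `∏ (a + b x_i)` in the direction `(-b, a)` is a linear combination
of elementary symmetric functions. -/
theorem sum_mul_prod_erase_eq_sum_esymm (m : ℕ) (a b : ℝ) :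
    ∃ γ : ℕ → ℝ, ∀ x : Fin m → ℝ,
      ∑ j, (a * x j - b) * ∏ i ∈ Finset.univ.erase j, (a + b * x i)
        = ∑ r ∈ Finset.range (m + 1), γ r * esymm x r := by
  refine ⟨fun r => (derivative ((C a - C b * X) ^ (m - r) * (C b + C a * X) ^ r)).eval 0,
    fun x => ?_⟩
  have h := congrArg (fun p : ℝ[X] => (derivative p).eval 0)
    (prod_add_mul_eq_sum_esymmOn Finset.univ x (C a - C b * X) (C b + C a * X))
  simp only [algebraMap_eq, Finset.card_univ, Fintype.card_fin, derivative_prod_finset,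
    derivative_sum, eval_finsetSum, eval_mul, eval_prod] at h
  refine Eq.trans (Finset.sum_congr rfl fun j _ => ?_) (h.trans (Finset.sum_congr rfl fun r _ => ?_))
  · simp
    ring
  · simp [esymm]

/-- A polynomial of degree at most `m` yields a solution of the extremality equation. -/
theorem exists_sum_esymm_of_polynomial {m : ℕ} (hm : 0 < m) {a b : ℝ}
    (hab : a ^ 2 + b ^ 2 ≠ 0) {p : ℝ[X]} (hp : p.natDegree ≤ m) :
    ∃ α : ℕ → ℝ, ∀ x : Fin m → ℝ, Function.Injective x → (∀ i, a + b * x i ≠ 0) →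
      ∑ j, (∏ i ∈ Finset.univ.erase j, (a + b * x i)) ^ 2 * p.eval (x j) / Delta x j
        = ∑ r ∈ Finset.range (m + 1), α r * esymm x r := by
  obtain ⟨q, hq, hpq⟩ := exists_projective_change hab hp
  obtain ⟨γ, hγ⟩ := sum_mul_prod_erase_eq_sum_esymm m a b
  refine ⟨fun r => (a ^ 2 + b ^ 2) ^ (m - 1) *
    (q.coeff (m - 1) * (a ^ (m - r) * b ^ r) + q.coeff m * γ r), fun x hx hl => ?_⟩
  have hdiff : ∀ i j, (a * x j - b) / (a + b * x j) - (a * x i - b) / (a + b * x i)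
      = (a ^ 2 + b ^ 2) * (x j - x i) / ((a + b * x j) * (a + b * x i)) := fun i j => by
    rw [div_sub_div _ _ (hl j) (hl i)]
    ring
  have hu : Function.Injective fun i => (a * x i - b) / (a + b * x i) := fun i j hij => by
    have h := hdiff j i
    rw [sub_eq_zero.2 hij] at h
    by_contra hne
    exact div_ne_zero (mul_ne_zero hab (sub_ne_zero.2 (hx.ne hne)))
      (mul_ne_zero (hl i) (hl j)) h.symm
  have hne : (Finset.univ : Finset (Fin m)).Nonempty := ⟨⟨0, hm⟩, Finset.mem_univ _⟩
  have hsum := sum_eval_div_prod_sub hne hu.injOn (q := q) (by simpa using hq)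
  simp only [Finset.card_univ, Fintype.card_fin] at hsum
  have hprod := prod_add_mul_eq_sum_esymmOn Finset.univ x a b
  simp only [Algebra.algebraMap_self, RingHom.id_apply, Finset.card_univ,
    Fintype.card_fin] at hprod
  calc _ = (a ^ 2 + b ^ 2) ^ (m - 1) * ((∏ i, (a + b * x i)) *
        (q.coeff (m - 1) + q.coeff m * ∑ j, (a * x j - b) / (a + b * x j))) := by
        rw [← hsum, Finset.mul_sum, Finset.mul_sum]
        refine Finset.sum_congr rfl fun j _ => ?_
        have hQ : ∏ i ∈ Finset.univ.erase j, (a + b * x i) ≠ 0 :=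
          Finset.prod_ne_zero_iff.2 fun i _ => hl i
        have hΔ : Delta x j ≠ 0 := Finset.prod_ne_zero_iff.2 fun i hi =>
          sub_ne_zero.2 (hx.ne (Finset.ne_of_mem_erase hi).symm)
        have hj := hl j
        rw [hpq _ hj, ← Finset.mul_prod_erase _ _ (Finset.mem_univ j)]
        simp_rw [hdiff]
        rw [Finset.prod_div_distrib, Finset.prod_mul_distrib, Finset.prod_mul_distrib,
          Finset.prod_const, Finset.prod_const, Finset.card_erase_of_mem (Finset.mem_univ j),
          Finset.card_univ, Fintype.card_fin, ← Delta,
          ← mul_pow_sub_one hm.ne' (a + b * x j)]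
        field_simp
    _ = (a ^ 2 + b ^ 2) ^ (m - 1) * (q.coeff (m - 1) * ∏ i, (a + b * x i) +
        q.coeff m * ∑ j, (a * x j - b) * ∏ i ∈ Finset.univ.erase j, (a + b * x i)) := by
        rw [mul_add, mul_comm (∏ i, (a + b * x i)) (q.coeff (m - 1)), mul_left_comm,
          Finset.mul_sum]
        congr 3
        refine Finset.sum_congr rfl fun j _ => ?_
        have hj := hl j
        rw [← Finset.mul_prod_erase _ _ (Finset.mem_univ j)]
        field_simp
    _ = _ := by
        rw [hγ, hprod, Finset.mul_sum, Finset.mul_sum, ← Finset.sum_add_distrib, Finset.mul_sum]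
        refine Finset.sum_congr rfl fun r _ => ?_
        simp only [esymm]
        ring

/-- `σ_r` is affine in each variable. -/
theorem exists_esymm_update_eq_eval {m : ℕ} (c : Fin m → ℝ) (k : Fin m) (r : ℕ) :
    ∃ p : ℝ[X], p.natDegree ≤ 1 ∧ ∀ y, p.eval y = esymm (Function.update c k y) r := by
  refine ⟨∑ s ∈ Finset.univ.powersetCard r, ∏ i ∈ s, if i = k then X else C (c i), ?_,
    fun y => ?_⟩
  · refine natDegree_sum_le_of_forall_le _ _ fun s _ => (natDegree_prod_le _ _).trans ?_
    calc ∑ i ∈ s, (if i = k then (X : ℝ[X]) else C (c i)).natDegree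
        ≤ ∑ i ∈ s, if i = k then 1 else 0 :=
          Finset.sum_le_sum fun i _ => by split_ifs <;> simp
      _ ≤ 1 := by
          rw [Finset.sum_ite_eq']
          split_ifs <;> simp
  · simp only [eval_finsetSum, eval_prod, esymm, esymmOn]
    refine Finset.sum_congr rfl fun s _ => Finset.prod_congr rfl fun i _ => ?_
    by_cases h : i = k <;> simp [h]

/-- Freezing all variables but `x_k` in the extremality equation exhibits `F k` as a polynomial
of degree at most `m`, which takes the values `F j (c j)` at the frozen nodes. -/
theorem exists_polynomial_of_sum_eq {m : ℕ} (hm : 2 ≤ m) {a b : ℝ} {I : Fin m → Set ℝ}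
    (hdisj : ∀ i j, i ≠ j → Disjoint (I i) (I j))
    (hnz : ∀ j, ∀ x ∈ I j, a + b * x ≠ 0) {F : Fin m → ℝ → ℝ} {α : ℕ → ℝ}
    (h : ∀ x : Fin m → ℝ, (∀ j, x j ∈ I j) →
      ∑ j, (∏ i ∈ Finset.univ.erase j, (a + b * x i)) ^ 2 * F j (x j) / Delta x j
        = ∑ r ∈ Finset.range (m + 1), α r * esymm x r)
    {c : Fin m → ℝ} (hc : ∀ j, c j ∈ I j) (k : Fin m) :
    ∃ p : ℝ[X], p.natDegree ≤ m ∧ (∀ y ∈ I k, p.eval y = F k y) ∧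
      ∀ j, j ≠ k → p.eval (c j) = F j (c j) := by
  have hmem : ∀ {i j : Fin m} {y z : ℝ}, i ≠ j → y ∈ I i → z ∈ I j → y ≠ z :=
    fun hij hy hz => (hdisj _ _ hij).ne_of_mem hy hz
  have hcinj : Function.Injective c := fun i j hij => by
    by_contra hne
    exact hmem hne (hc i) (hc j) hij
  choose σ hσdeg hσ using exists_esymm_update_eq_eval c k
  set s := Finset.univ.erase k with hs
  set Q := ∏ i ∈ s, (a + b * c i) with hQdef
  have hQ : Q ≠ 0 := Finset.prod_ne_zero_iff.2 fun i _ => hnz i _ (hc i)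
  set ρ : Fin m → ℝ := fun j => (∏ i ∈ s.erase j, (a + b * c i)) ^ 2 * F j (c j) with hρ
  set N := Lagrange.nodal s c
  set L := Lagrange.interpolate s c ρ with hL
  set S := ∑ r ∈ Finset.range (m + 1), C (α r) * σ r with hS
  have hcard : s.card = m - 1 := by simp [hs]
  refine ⟨C ((Q ^ 2)⁻¹) * (N * S + (C b * X + C a) ^ 2 * L), ?_, fun y hy => ?_, fun j hj => ?_⟩
  · refine (natDegree_C_mul_le _ _).trans (natDegree_add_le_of_degree_le ?_ ?_)
    · refine natDegree_mul_le.trans ?_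
      have h1 : S.natDegree ≤ 1 := natDegree_sum_le_of_forall_le _ _ fun r _ =>
        (natDegree_C_mul_le _ _).trans (hσdeg r)
      rw [Lagrange.natDegree_nodal, hcard]
      omega
    · refine natDegree_mul_le.trans ?_
      have h1 : ((C b * X + C a) ^ 2).natDegree ≤ 2 * 1 :=
        natDegree_pow_le_of_le 2 natDegree_linear_le
      have h2 : L.natDegree ≤ m - 2 := natDegree_le_of_degree_le <| by
        have := Lagrange.degree_interpolate_le (s := s) (v := c) ρ hcinj.injOn
        rwa [hcard, Nat.sub_sub] at this
      omega
  · set x := Function.update c k y with hx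
    have hxk : x k = y := by simp [hx]
    have hxi : ∀ i, i ≠ k → x i = c i := fun i hi => by simp [hx, hi]
    have hxI : ∀ j, x j ∈ I j := fun j => by
      by_cases hj : j = k
      · subst hj
        rwa [hxk]
      · rw [hxi j hj]
        exact hc j
    have hyc : ∀ i ∈ s, y ≠ c i := fun i hi =>
      hmem (Finset.ne_of_mem_erase hi).symm hy (hc i)
    have hN : N.eval y ≠ 0 := Lagrange.eval_nodal_not_at_node hyc
    have heq := h x hxI
    have hΔ : Delta x k = N.eval y := by
      rw [Lagrange.eval_nodal, Delta, hxk]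
      exact Finset.prod_congr rfl fun i hi => by rw [hxi i (Finset.ne_of_mem_erase hi)]
    have hQk : ∏ i ∈ s, (a + b * x i) = Q :=
      Finset.prod_congr rfl fun i hi => by rw [hxi i (Finset.ne_of_mem_erase hi)]
    have hother : ∑ j ∈ s, (∏ i ∈ Finset.univ.erase j, (a + b * x i)) ^ 2 * F j (x j) / Delta x j
        = -((a + b * y) ^ 2 *
          ∑ j ∈ s, Lagrange.nodalWeight s c j * (y - c j)⁻¹ * ρ j) := by
      rw [Finset.mul_sum, ← Finset.sum_neg_distrib]
      refine Finset.sum_congr rfl fun j hj => ?_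
      have hjk := Finset.ne_of_mem_erase hj
      have hk : k ∈ Finset.univ.erase j := Finset.mem_erase.2 ⟨hjk.symm, Finset.mem_univ _⟩
      have hcongr : ∀ f g : Fin m → ℝ, (∀ i, i ≠ k → f i = g i) →
          ∏ i ∈ Finset.univ.erase j, f i = f k * ∏ i ∈ s.erase j, g i := fun f g hfg => by
        rw [← Finset.mul_prod_erase _ _ hk, Finset.erase_right_comm]
        congr 1
        exact Finset.prod_congr rfl fun i hi =>
          hfg i (Finset.ne_of_mem_erase (Finset.mem_of_mem_erase hi))
      rw [Delta, hcongr _ (fun i => a + b * c i) fun i hi => by rw [hxi i hi],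
        hcongr _ (fun i => c j - c i) fun i hi => by rw [hxi i hi, hxi j hjk], hxk, hxi j hjk,
        Lagrange.nodalWeight, Finset.prod_inv_distrib, ← neg_sub y (c j), hρ]
      simp only [div_eq_mul_inv, mul_inv, inv_neg]
      ring
    rw [← Finset.add_sum_erase _ _ (Finset.mem_univ k), ← hs, hother, hΔ, hQk, hxk] at heq
    have hSy : S.eval y = ∑ r ∈ Finset.range (m + 1), α r * esymm x r := by
      simp [hS, eval_finsetSum, hσ, hx]
    simp only [eval_mul, eval_add, eval_pow, eval_C, eval_X]
    rw [hL, Lagrange.eval_interpolate_not_at_node ρ hyc, hSy, ← heq]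
    field_simp
    ring
  · have hjs : j ∈ s := Finset.mem_erase.2 ⟨hj, Finset.mem_univ _⟩
    simp only [eval_mul, eval_add, eval_pow, eval_C, eval_X]
    rw [Lagrange.eval_nodal_at_node hjs, hL,
      Lagrange.eval_interpolate_at_node ρ hcinj.injOn hjs, hρ, hQdef,
      ← Finset.mul_prod_erase _ _ hjs]
    rw [hQdef, ← Finset.mul_prod_erase _ _ hjs] at hQ
    have := left_ne_zero_of_mul hQ
    have := right_ne_zero_of_mul hQ
    field_simp
    ring

end

/-- if `β_r = t·a^(m−r)·b^r` for some `t ≠ 0` and `(a,b) ≠ (0,0)`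
(equivalently `P(x) = t·∏_{j=1}^m (a + b x_j)`; in particular `a + b x ≠ 0` on each `I_j`),
then `(A₁,…,A_m)` is extremal iff there is a single real polynomial `Υ` of degree at most `m`
with `(a+bx)^(m+3) · d²/dx² [A_j(x)/(a+bx)^(m+1)] = Υ(x)` on `I_j` for every `j`. -/
theorem statement0 (m : ℕ) (hm : 2 ≤ m)
    (β : ℕ → ℝ) (hβ : ∃ r ≤ m, β r ≠ 0)
    (I : Fin m → Set ℝ)
    (hI : ∀ j, ∃ u v : ℝ, u < v ∧ I j = Set.Ioo u v)
    (hdisj : ∀ i j : Fin m, i ≠ j → Disjoint (I i) (I j))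
    (A : Fin m → ℝ → ℝ) (hA : ∀ j, ContDiffOn ℝ (⊤ : ℕ∞) (A j) (I j))
    (hP : ∀ x : Fin m → ℝ, (∀ j, x j ∈ I j) → Pfun m β x ≠ 0)
    (t a b : ℝ) (ht : t ≠ 0) (hab : (a, b) ≠ (0, 0))
    (hβdec : ∀ r ≤ m, β r = t * a ^ (m - r) * b ^ r)
    (hnz : ∀ j : Fin m, ∀ x ∈ I j, a + b * x ≠ 0) :
    IsExtremalV m β I A ↔
      ∃ Υ : Polynomial ℝ, Υ.natDegree ≤ m ∧
        ∀ j : Fin m, ∀ x ∈ I j,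
          (a + b * x) ^ (m + 3) *
              deriv (deriv (fun y => A j y / (a + b * y) ^ (m + 1))) x
            = Υ.eval x := by
  have hF : ∀ j : Fin m, ∀ x ∈ I j, (a + b * x) ^ (m + 3) *
      deriv (deriv (fun y => A j y / (a + b * y) ^ (m + 1))) x = twistedOp m a b (A j) x := by
    intro j x hx
    obtain ⟨u, v, -, hIj⟩ := hI j
    exact mul_deriv_deriv_div_affine_pow (hIj ▸ isOpen_Ioo) (hA j) (hnz j) hx
  have hterm : ∀ x : Fin m → ℝ, (∑ j : Fin m,
      ((Pfun m β x) ^ 2 * deriv (deriv (A j)) (x j)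
        - 2 * ((m : ℝ) + 1) * Pfun m β x * dPfun m β x j * deriv (A j) (x j)
        + ((m : ℝ) + 1) * ((m : ℝ) + 2) * (dPfun m β x j) ^ 2 * A j (x j)) / Delta x j)
      = t ^ 2 * ∑ j, (∏ i ∈ Finset.univ.erase j, (a + b * x i)) ^ 2 *
          twistedOp m a b (A j) (x j) / Delta x j := fun x => by
    rw [Finset.mul_sum]
    refine Finset.sum_congr rfl fun j _ => ?_
    rw [extremal_term_eq hβdec]
    ring
  have ht2 : t ^ 2 ≠ 0 := pow_ne_zero 2 ht
  constructor
  · rintro ⟨α, hα⟩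
    have hα' : ∀ x : Fin m → ℝ, (∀ j, x j ∈ I j) →
        ∑ j, (∏ i ∈ Finset.univ.erase j, (a + b * x i)) ^ 2 *
          twistedOp m a b (A j) (x j) / Delta x j
        = ∑ r ∈ Finset.range (m + 1), (α r / t ^ 2) * esymm x r := fun x hx => by
      have h := hα x hx
      rw [hterm] at h
      rw [eq_div_of_mul_eq ht2 ((mul_comm _ _).trans h), Finset.sum_div]
      exact Finset.sum_congr rfl fun r _ => by ring
    have hne : ∀ j, (I j).Nonempty := fun j => by
      obtain ⟨u, v, huv, hIj⟩ := hI j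
      rw [hIj]
      exact Set.nonempty_Ioo.2 huv
    choose c hc using hne
    let k : Fin m := ⟨0, by omega⟩
    obtain ⟨Υ, hdeg, hk, -⟩ := exists_polynomial_of_sum_eq hm hdisj hnz hα' hc k
    refine ⟨Υ, hdeg, fun j x hx => ?_⟩
    rw [hF j x hx]
    by_cases hj : j = k
    · subst hj
      exact (hk x hx).symm
    · obtain ⟨p, -, hpk, hpj⟩ := exists_polynomial_of_sum_eq hm hdisj hnz hα'
        (c := Function.update c j x) (fun i => by
          by_cases hij : i = j
          · subst hij
            simpa using hx
          · simpa [hij] using hc i) k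
      have hpΥ : p = Υ := by
        obtain ⟨u, v, huv, hIk⟩ := hI k
        refine Polynomial.eq_of_infinite_eval_eq _ _ ((Set.Ioo_infinite huv).mono fun y hy => ?_)
        rw [← hIk] at hy
        exact (hpk y hy).trans (hk y hy).symm
      simpa [hpΥ] using (hpj j hj).symm
  · rintro ⟨Υ, hdeg, hΥ⟩
    have hab' : a ^ 2 + b ^ 2 ≠ 0 := fun h => hab <| by
      rw [Prod.mk.injEq]
      constructor <;> nlinarith [sq_nonneg a, sq_nonneg b]
    obtain ⟨α, hα⟩ := exists_sum_esymm_of_polynomial (by omega) hab' hdeg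
    refine ⟨fun r => t ^ 2 * α r, fun x hx => ?_⟩
    have hinj : Function.Injective x := fun i j hij => by
      by_contra hne
      exact (hdisj i j hne).ne_of_mem (hx i) (hx j) hij
    simp_rw [hterm, mul_assoc (t ^ 2), ← Finset.mul_sum]
    rw [← hα x hinj fun i => hnz i _ (hx i)]
    congr 1
    exact Finset.sum_congr rfl fun j _ => by rw [← hF j _ (hx j), hΥ j _ (hx j)]

end
end

section
/- Assume m ≥ 3 and that there do not exist real numbers t, a, b with β_r = t·a^(m−r)·b^r for all r = 0,…,m (i.e. the defining element of the Veronese structure is indecomposable). Then (A₁,…,A_m) is extremal if and only if there exists a single real polynomial Υ of degree at most m+2 such that A_j(x) = Υ(x) for all x ∈ I_j and all j = 1,…,m. -/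
noncomputable section

open Polynomial

/-- The multiaffine symmetric function `∑_r β_r σ_r` of the variables indexed by `S`. -/
def multiaffine {n : ℕ} (S : Finset (Fin n)) (β : ℕ → ℝ) (x : Fin n → ℝ) : ℝ :=
  ∑ r ∈ Finset.range (S.card + 1), β r * esymmOn S x r

section Multiaffine

variable {n : ℕ} {S : Finset (Fin n)}

lemma esymmOn_zero (x : Fin n → ℝ) : esymmOn S x 0 = 1 := by
  simp [esymmOn]

lemma esymmOn_of_card_lt (x : Fin n → ℝ) {r : ℕ} (h : S.card < r) : esymmOn S x r = 0 := by
  simp [esymmOn, Finset.powersetCard_eq_empty.2 h]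

lemma esymmOn_congr {x y : Fin n → ℝ} (h : ∀ i ∈ S, x i = y i) (r : ℕ) :
    esymmOn S x r = esymmOn S y r :=
  Finset.sum_congr rfl fun _ ht => Finset.prod_congr rfl fun i hi =>
    h i ((Finset.mem_powersetCard.1 ht).1 hi)

lemma esymmOn_insert_succ {k : Fin n} (hk : k ∉ S) (x : Fin n → ℝ) (r : ℕ) :
    esymmOn (insert k S) x (r + 1) = esymmOn S x (r + 1) + x k * esymmOn S x r := by
  unfold esymmOn
  rw [Finset.powersetCard_succ_insert hk, Finset.sum_union, Finset.sum_image, Finset.mul_sum]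
  · congr 1
    refine Finset.sum_congr rfl fun _ ht => ?_
    rw [Finset.prod_insert fun h => hk ((Finset.mem_powersetCard.1 ht).1 h)]
  · intro s hs t ht hst
    have hks : k ∉ s := fun h => hk ((Finset.mem_powersetCard.1 hs).1 h)
    have hkt : k ∉ t := fun h => hk ((Finset.mem_powersetCard.1 ht).1 h)
    simpa [Finset.erase_insert hks, Finset.erase_insert hkt] using
      congrArg (fun u => u.erase k) hst
  · refine Finset.disjoint_left.2 fun t ht ht' => ?_
    obtain ⟨s, -, rfl⟩ := Finset.mem_image.1 ht'
    exact hk ((Finset.mem_powersetCard.1 ht).1 (Finset.mem_insert_self k s))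

lemma esymmOn_const (y : ℝ) (r : ℕ) :
    esymmOn S (fun _ => y) r = (S.card.choose r : ℝ) * y ^ r := by
  unfold esymmOn
  rw [Finset.sum_congr rfl fun _ ht => by
    rw [Finset.prod_const, (Finset.mem_powersetCard.1 ht).2]]
  simp

lemma multiaffine_congr {β γ : ℕ → ℝ} {x y : Fin n → ℝ} (hβ : ∀ r ≤ S.card, β r = γ r)
    (h : ∀ i ∈ S, x i = y i) : multiaffine S β x = multiaffine S γ y :=
  Finset.sum_congr rfl fun r hr => by
    rw [hβ r (by simpa [Nat.lt_succ_iff] using hr), esymmOn_congr h]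

lemma multiaffine_add_mul (β γ : ℕ → ℝ) (c : ℝ) (x : Fin n → ℝ) :
    multiaffine S (fun r => β r + c * γ r) x = multiaffine S β x + c * multiaffine S γ x := by
  simp only [multiaffine, Finset.mul_sum, ← Finset.sum_add_distrib]
  exact Finset.sum_congr rfl fun _ _ => by ring

lemma multiaffine_insert {k : Fin n} (hk : k ∉ S) (β : ℕ → ℝ) (x : Fin n → ℝ) :
    multiaffine (insert k S) β x = multiaffine S (fun r => β r + x k * β (r + 1)) x := by
  rw [multiaffine_add_mul]
  unfold multiaffine
  rw [Finset.card_insert_of_notMem hk, Finset.sum_range_succ', esymmOn_zero]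
  have h : ∑ r ∈ Finset.range (S.card + 1), β r * esymmOn S x r
      = ∑ r ∈ Finset.range (S.card + 1), β (r + 1) * esymmOn S x (r + 1) + β 0 * 1 := by
    rw [← esymmOn_zero (S := S) x, ← Finset.sum_range_succ' (fun r => β r * esymmOn S x r),
      Finset.sum_range_succ _ (S.card + 1), esymmOn_of_card_lt x (Nat.lt_succ_self _), mul_zero,
      add_zero]
  rw [h, Finset.mul_sum, add_right_comm, ← Finset.sum_add_distrib]
  congr 1
  exact Finset.sum_congr rfl fun r _ => by rw [esymmOn_insert_succ hk]; ring

lemma multiaffine_pow (p : ℝ) (x : Fin n → ℝ) :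
    multiaffine S (fun r => p ^ (S.card - r)) x = ∏ i ∈ S, (x i + p) := by
  induction S using Finset.induction_on with
  | empty => simp [multiaffine, esymmOn]
  | insert k S hk ih =>
    rw [multiaffine_insert hk, Finset.prod_insert hk, ← ih, Finset.card_insert_of_notMem hk,
      multiaffine, multiaffine, Finset.mul_sum]
    refine Finset.sum_congr rfl fun r hr => ?_
    have hr' : r ≤ S.card := by simpa [Nat.lt_succ_iff] using hr
    rw [Nat.succ_sub_succ, Nat.succ_sub hr', pow_succ]
    ring

end Multiaffine

section Polar

variable {m : ℕ}

lemma Pfun_eq_multiaffine (β : ℕ → ℝ) (x : Fin m → ℝ) :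
    Pfun m β x = multiaffine Finset.univ β x := by
  simp [Pfun, multiaffine, esymm]

lemma dPfun_eq_multiaffine (β : ℕ → ℝ) (x : Fin m → ℝ) (j : Fin m) :
    dPfun m β x j = multiaffine (Finset.univ.erase j) (fun r => β (r + 1)) x := by
  have : m - 1 + 1 = m := Nat.sub_add_cancel (Nat.one_le_of_lt j.2)
  simp [dPfun, multiaffine, esymmHat, this]

lemma Pfun_eq_add_mul_dPfun (β : ℕ → ℝ) (x : Fin m → ℝ) (j : Fin m) :
    Pfun m β x = multiaffine (Finset.univ.erase j) β x + x j * dPfun m β x j := by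
  rw [Pfun_eq_multiaffine, dPfun_eq_multiaffine, ← multiaffine_add_mul, ← multiaffine_insert,
    Finset.insert_erase (Finset.mem_univ j)]
  exact Finset.notMem_erase j _

lemma dPfun_eq_add_mul {i j : Fin m} (hij : i ≠ j) (β : ℕ → ℝ) (x : Fin m → ℝ) :
    dPfun m β x i = multiaffine ((Finset.univ.erase i).erase j) (fun r => β (r + 1)) x
      + x j * multiaffine ((Finset.univ.erase i).erase j) (fun r => β (r + 2)) x := by
  rw [dPfun_eq_multiaffine, ← multiaffine_add_mul,
    ← multiaffine_insert (Finset.notMem_erase j _) (fun r => β (r + 1)) x,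
    Finset.insert_erase (by simp [hij.symm])]

lemma multiaffine_update {S : Finset (Fin m)} {j : Fin m} (hj : j ∉ S) (β : ℕ → ℝ)
    (x : Fin m → ℝ) (t : ℝ) : multiaffine S β (Function.update x j t) = multiaffine S β x :=
  multiaffine_congr (fun _ _ => rfl) fun _ hi =>
    Function.update_of_ne (ne_of_mem_of_not_mem hi hj) t x

lemma dPfun_update_self (β : ℕ → ℝ) (x : Fin m → ℝ) (j : Fin m) (t : ℝ) :
    dPfun m β (Function.update x j t) j = dPfun m β x j := by
  rw [dPfun_eq_multiaffine, dPfun_eq_multiaffine, multiaffine_update (Finset.notMem_erase j _)]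

lemma Pfun_update (β : ℕ → ℝ) (x : Fin m → ℝ) (j : Fin m) (t : ℝ) :
    Pfun m β (Function.update x j t)
      = multiaffine (Finset.univ.erase j) β x + t * dPfun m β x j := by
  rw [Pfun_eq_add_mul_dPfun β _ j, dPfun_update_self, multiaffine_update (Finset.notMem_erase j _),
    Function.update_self]

lemma dPfun_eq_of_eq {i j : Fin m} (β : ℕ → ℝ) {x : Fin m → ℝ} (h : x i = x j) :
    dPfun m β x i = dPfun m β x j := by
  rcases eq_or_ne i j with rfl | hij
  · rfl
  · rw [dPfun_eq_add_mul hij, dPfun_eq_add_mul hij.symm, Finset.erase_right_comm, h]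

end Polar

/-- `f` is a polynomial function of degree at most `d`. -/
def IsPolyLE (d : ℕ) (f : ℝ → ℝ) : Prop :=
  ∃ p : ℝ[X], p.natDegree ≤ d ∧ ∀ t, f t = p.eval t

namespace IsPolyLE

variable {d e : ℕ} {f g : ℝ → ℝ}

lemma mono (h : IsPolyLE d f) (hde : d ≤ e) : IsPolyLE e f := by
  obtain ⟨p, hp, h⟩ := h
  exact ⟨p, hp.trans hde, h⟩

lemma add (hf : IsPolyLE d f) (hg : IsPolyLE d g) : IsPolyLE d fun t => f t + g t := by
  obtain ⟨p, hp, hf⟩ := hf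
  obtain ⟨q, hq, hg⟩ := hg
  exact ⟨p + q, (natDegree_add_le p q).trans (max_le hp hq), fun t => by simp [hf, hg]⟩

lemma mul (hf : IsPolyLE d f) (hg : IsPolyLE e g) : IsPolyLE (d + e) fun t => f t * g t := by
  obtain ⟨p, hp, hf⟩ := hf
  obtain ⟨q, hq, hg⟩ := hg
  exact ⟨p * q, natDegree_mul_le_of_le hp hq, fun t => by simp [hf, hg]⟩

lemma const (c : ℝ) : IsPolyLE d fun _ => c :=
  ⟨C c, by simp, by simp⟩

lemma affine (a b : ℝ) : IsPolyLE 1 fun t => a + t * b :=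
  ⟨C a + X * C b, by compute_degree, fun t => by simp only [eval_add, eval_mul, eval_C, eval_X]⟩

lemma const_mul (hf : IsPolyLE d f) (c : ℝ) : IsPolyLE d fun t => c * f t := by
  simpa using (const (d := 0) c).mul hf

lemma sum {ι : Type*} (s : Finset ι) {f : ι → ℝ → ℝ} (h : ∀ i ∈ s, IsPolyLE d (f i)) :
    IsPolyLE d fun t => ∑ i ∈ s, f i t := by
  choose! p hp hf using h
  refine ⟨∑ i ∈ s, p i, natDegree_sum_le_of_forall_le s p hp, fun t => ?_⟩
  rw [eval_finsetSum]
  exact Finset.sum_congr rfl fun i hi => hf i hi t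

lemma prod_sub {ι : Type*} (s : Finset ι) (x : ι → ℝ) :
    IsPolyLE s.card fun t => ∏ i ∈ s, (t - x i) :=
  ⟨∏ i ∈ s, (X - C (x i)), by simp, fun t => by simp [eval_prod]⟩

end IsPolyLE

section ClearDenominators

variable {m : ℕ}

lemma Delta_eq_mul {j k : Fin m} (h : j ≠ k) (x : Fin m → ℝ) :
    Delta x j = (x j - x k) * ∏ l ∈ (Finset.univ.erase j).erase k, (x j - x l) :=
  (Finset.mul_prod_erase _ _ (by simp [h.symm])).symm

lemma Delta_ne_zero {x : Fin m → ℝ} (hx : Function.Injective x) (j : Fin m) : Delta x j ≠ 0 :=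
  Finset.prod_ne_zero_iff.2 fun i hi => sub_ne_zero.2 fun h => by
    simp [hx h] at hi

lemma numerator_eq_of_sum_div_Delta {x : Fin m → ℝ} (hx : Function.Injective x) (j : Fin m)
    (n : Fin m → ℝ) {F : ℝ} (h : ∑ k, n k / Delta x k = F) :
    n j = Delta x j * F + ∑ k ∈ Finset.univ.erase j,
      (∏ l ∈ (Finset.univ.erase k).erase j, (x k - x l))⁻¹ *
        (n k * ∏ l ∈ (Finset.univ.erase k).erase j, (x j - x l)) := by
  rw [← Finset.add_sum_erase _ _ (Finset.mem_univ j)] at h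
  rw [← h, mul_add, mul_div_cancel₀ _ (Delta_ne_zero hx j), add_assoc, Finset.mul_sum,
    ← Finset.sum_add_distrib, Finset.sum_eq_zero, add_zero]
  intro k hk
  have hkj : k ≠ j := Finset.ne_of_mem_erase hk
  have h1 : x j - x k ≠ 0 := sub_ne_zero.2 fun h => hkj (hx h).symm
  have h2 : x k - x j ≠ 0 := sub_ne_zero.2 fun h => hkj (hx h)
  have h3 : ∏ l ∈ (Finset.univ.erase k).erase j, (x k - x l) ≠ 0 :=
    (mul_ne_zero_iff.1 (Delta_eq_mul hkj x ▸ Delta_ne_zero hx k)).2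
  rw [Delta_eq_mul hkj, Delta_eq_mul hkj.symm, Finset.erase_right_comm]
  field_simp
  ring

/-- Clearing denominators in `∑ₖ nₖ / Δₖ = F` along the `j`-th variable: the numerator `n j`
extends to a polynomial, which takes the value of `n i` on the diagonal `x j = x i`. -/
lemma exists_polynomial_numerator (hm : 2 ≤ m) {x : Fin m → ℝ} (j : Fin m) {T : Set ℝ}
    (hT : ∀ t ∈ T, Function.Injective (Function.update x j t))
    (hx : Function.Injective x)
    (n : Fin m → ℝ → ℝ) (hn : ∀ k ≠ j, IsPolyLE 2 (n k)) {F : ℝ → ℝ} (hF : IsPolyLE 1 F)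
    (h : ∀ t ∈ T, ∑ k, n k t / Delta (Function.update x j t) k = F t) :
    ∃ R : ℝ[X], R.natDegree ≤ m ∧ (∀ t ∈ T, n j t = R.eval t) ∧
      ∀ i ≠ j, n i (x i) = R.eval (x i) := by
  have hcard (k : Fin m) (hk : k ≠ j) : ((Finset.univ.erase k).erase j).card = m - 2 := by
    rw [Finset.card_erase_of_mem (by simp [hk.symm]), Finset.card_erase_of_mem (by simp)]
    simp; omega
  have hcard' : (Finset.univ.erase j).card = m - 1 := by simp
  have key : IsPolyLE m fun t => (∏ l ∈ Finset.univ.erase j, (t - x l)) * F t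
      + ∑ k ∈ Finset.univ.erase j,
      (∏ l ∈ (Finset.univ.erase k).erase j, (x k - x l))⁻¹ *
        (n k t * ∏ l ∈ (Finset.univ.erase k).erase j, (t - x l)) := by
    refine .add (((IsPolyLE.prod_sub _ x).mul hF).mono (by omega)) (.sum _ fun k hk => ?_)
    have hkj := Finset.ne_of_mem_erase hk
    refine .const_mul (((hn k hkj).mul (.prod_sub _ x)).mono ?_) _
    rw [hcard k hkj]; omega
  obtain ⟨R, hR, hRe⟩ := key
  have hupd {s : Finset (Fin m)} (hs : j ∉ s) {t : ℝ} {l : Fin m} (hl : l ∈ s) :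
      Function.update x j t l = x l := Function.update_of_ne (ne_of_mem_of_not_mem hl hs) t x
  refine ⟨R, hR, fun t ht => ?_, fun i hi => ?_⟩
  · rw [numerator_eq_of_sum_div_Delta (hT t ht) j (fun k => n k t) (h t ht), ← hRe]
    have hprod {s : Finset (Fin m)} (hs : j ∉ s) (c : ℝ) :
        ∏ l ∈ s, (c - Function.update x j t l) = ∏ l ∈ s, (c - x l) :=
      Finset.prod_congr rfl fun l hl => by rw [hupd hs hl]
    simp only [Delta, Function.update_self]
    rw [hprod (Finset.notMem_erase j _)]
    congr 1
    refine Finset.sum_congr rfl fun k hk => ?_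
    rw [hprod (Finset.notMem_erase j _), hprod (Finset.notMem_erase j _),
      hupd (Finset.notMem_erase j _) hk]
  · have hij : i ∈ Finset.univ.erase j := by simp [hi]
    rw [← hRe]
    beta_reduce
    rw [Finset.prod_eq_zero hij (sub_self (x i)), zero_mul, zero_add,
      Finset.sum_eq_single_of_mem i hij fun k _ hki => ?_]
    · have : ∏ l ∈ (Finset.univ.erase i).erase j, (x i - x l) ≠ 0 :=
        (mul_ne_zero_iff.1 (Delta_eq_mul hi x ▸ Delta_ne_zero hx i)).2
      field_simp
    · rw [Finset.prod_eq_zero (i := i) (f := fun l => x i - x l) (by simp [hi, hki.symm])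
        (sub_self (x i)), mul_zero, mul_zero]

end ClearDenominators

section Bol

lemma exists_derivative_eq (q : ℝ[X]) {d : ℕ} (hq : q.natDegree ≤ d) :
    ∃ p : ℝ[X], p.natDegree ≤ d + 1 ∧ derivative p = q := by
  refine ⟨∑ i ∈ Finset.range (d + 1), monomial (i + 1) (q.coeff i / (i + 1)),
    natDegree_sum_le_of_forall_le _ _ fun i hi => (natDegree_monomial_le _).trans ?_, ?_⟩
  · simpa using hi
  · rw [derivative_sum]
    conv_rhs => rw [as_sum_range' q (d + 1) (by omega)]
    refine Finset.sum_congr rfl fun i _ => ?_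
    rw [derivative_monomial]
    push_cast
    rw [div_mul_cancel₀ _ (by positivity)]

variable {u v : ℝ}

lemma exists_polynomial_of_hasDerivAt_eq_zero (d : ℕ) (a : ℕ → ℝ → ℝ)
    (ha : ∀ k, ∀ t ∈ Set.Ioo u v, HasDerivAt (a k) (a (k + 1) t) t)
    (h : ∀ t ∈ Set.Ioo u v, a (d + 1) t = 0) :
    ∃ p : ℝ[X], p.natDegree ≤ d ∧ ∀ t ∈ Set.Ioo u v, a 0 t = p.eval t := by
  induction d generalizing a with
  | zero =>
    obtain ⟨c, hc⟩ := isOpen_Ioo.exists_is_const_of_deriv_eq_zero isPreconnected_Ioo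
      (fun t ht => (ha 0 t ht).differentiableAt.differentiableWithinAt)
      (fun t ht => (ha 0 t ht).deriv.trans (h t ht))
    exact ⟨C c, by simp, by simpa using hc⟩
  | succ d ih =>
    obtain ⟨q, hq, hqa⟩ := ih (fun k => a (k + 1)) (fun k => ha (k + 1)) h
    obtain ⟨p, hp, rfl⟩ := exists_derivative_eq q hq
    obtain ⟨c, hc⟩ := isOpen_Ioo.exists_eq_add_of_deriv_eq (𝕜 := ℝ) isPreconnected_Ioo
      (fun t ht => (ha 0 t ht).differentiableAt.differentiableWithinAt)
      p.differentiable.differentiableOn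
      (fun t ht => by rw [(ha 0 t ht).deriv, p.deriv]; exact hqa t ht)
    exact ⟨p + C c, (natDegree_add_C).trans_le hp, fun t ht => by simpa using hc ht⟩

lemma hasDerivAt_unique_on {f g : ℝ → ℝ} {f' g' t : ℝ} (hfg : Set.EqOn f g (Set.Ioo u v))
    (ht : t ∈ Set.Ioo u v) (hf : HasDerivAt f f' t) (hg : HasDerivAt g g' t) : f' = g' :=
  hf.unique (hg.congr_of_eventuallyEq (hfg.eventuallyEq_of_mem (isOpen_Ioo.mem_nhds ht)))

/-- Bol's lemma: with `N` the numerator of the extremality operator, the derivative of order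
`m + 1` of `N` is `(p + q t) ^ 2` times the derivative of order `m + 3` of the function. -/
lemma exists_polynomial_of_numerator (m : ℕ) (p q : ℝ) (a : ℕ → ℝ → ℝ)
    (ha : ∀ k, ∀ t ∈ Set.Ioo u v, HasDerivAt (a k) (a (k + 1) t) t)
    (hpq : ∀ t ∈ Set.Ioo u v, p + t * q ≠ 0)
    {R : ℝ[X]} (hR : R.natDegree ≤ m)
    (h : ∀ t ∈ Set.Ioo u v, (p + t * q) ^ 2 * a 2 t
      - 2 * ((m : ℝ) + 1) * (p + t * q) * q * a 1 t
      + ((m : ℝ) + 1) * ((m : ℝ) + 2) * q ^ 2 * a 0 t = R.eval t) :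
    ∃ P : ℝ[X], P.natDegree ≤ m + 2 ∧ ∀ t ∈ Set.Ioo u v, a 0 t = P.eval t := by
  have key (k : ℕ) : ∀ t ∈ Set.Ioo u v, (p + t * q) ^ 2 * a (k + 2) t
      + 2 * ((k : ℝ) - m - 1) * (p + t * q) * q * a (k + 1) t
      + ((k : ℝ) - m - 1) * ((k : ℝ) - m - 2) * q ^ 2 * a k t
        = (derivative^[k] R).eval t := by
    induction k with
    | zero =>
      intro t ht
      rw [Function.iterate_zero_apply, ← h t ht]
      push_cast
      ring
    | succ k ih =>
      intro t ht
      have hl : HasDerivAt (fun t => p + t * q) q t := by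
        simpa using ((hasDerivAt_id t).mul_const q).const_add p
      have h1 := (((hl.pow 2).mul (ha (k + 2) t ht)).add
        (((hl.const_mul (2 * ((k : ℝ) - m - 1))).mul_const q).mul (ha (k + 1) t ht))).add
        ((ha k t ht).const_mul (((k : ℝ) - m - 1) * ((k : ℝ) - m - 2) * q ^ 2))
      have h2 := hasDerivAt_unique_on (fun t ht => ih t ht) ht h1
        (Polynomial.hasDerivAt _ t)
      rw [Function.iterate_succ_apply', ← h2]
      simp only [Pi.pow_apply]
      push_cast
      ring
  refine exists_polynomial_of_hasDerivAt_eq_zero (m + 2) a ha fun t ht => ?_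
  have h0 := key (m + 1) t ht
  rw [iterate_derivative_eq_zero (by omega)] at h0
  push_cast at h0
  rw [show m + 2 + 1 = m + 1 + 2 by ring]
  have : (p + t * q) ^ 2 * a (m + 1 + 2) t = 0 := by
    rw [eval_zero] at h0
    linear_combination h0
  exact (mul_eq_zero.1 this).resolve_left (pow_ne_zero 2 (hpq t ht))

lemma hasDerivAt_iterate_deriv {f : ℝ → ℝ} (hf : ContDiffOn ℝ (⊤ : ℕ∞) f (Set.Ioo u v)) (k : ℕ) :
    ∀ t ∈ Set.Ioo u v, HasDerivAt (deriv^[k] f) (deriv^[k + 1] f t) t := by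
  have hk : ContDiffOn ℝ (⊤ : ℕ∞) (deriv^[k] f) (Set.Ioo u v) := by
    induction k with
    | zero => exact hf
    | succ k ih =>
      rw [Function.iterate_succ_apply']
      exact ((contDiffOn_infty_iff_deriv_of_isOpen isOpen_Ioo).1 ih).2
  intro t ht
  rw [Function.iterate_succ_apply']
  exact ((hk.differentiableOn (by simp)).differentiableAt (isOpen_Ioo.mem_nhds ht)).hasDerivAt

end Bol

section Numerator

variable {m : ℕ}

/-- The polarization in `β` of the numerators of the extremality equation, with `a₀, a₁, a₂`
standing for the values of `A_j, A_j', A_j''` at `x_j`. -/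
def numerator (m : ℕ) (β γ : ℕ → ℝ) (x : Fin m → ℝ) (j : Fin m) (a₀ a₁ a₂ : ℝ) : ℝ :=
  Pfun m β x * Pfun m γ x * a₂
    - ((m : ℝ) + 1) * (Pfun m β x * dPfun m γ x j + dPfun m β x j * Pfun m γ x) * a₁
    + ((m : ℝ) + 1) * ((m : ℝ) + 2) * (dPfun m β x j * dPfun m γ x j) * a₀

lemma numerator_self (β : ℕ → ℝ) (x : Fin m → ℝ) (j : Fin m) (a₀ a₁ a₂ : ℝ) :
    numerator m β β x j a₀ a₁ a₂ = (Pfun m β x) ^ 2 * a₂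
        - 2 * ((m : ℝ) + 1) * Pfun m β x * dPfun m β x j * a₁
        + ((m : ℝ) + 1) * ((m : ℝ) + 2) * (dPfun m β x j) ^ 2 * a₀ := by
  unfold numerator
  ring

lemma numerator_comm (β γ : ℕ → ℝ) (x : Fin m → ℝ) (j : Fin m) (a₀ a₁ a₂ : ℝ) :
    numerator m β γ x j a₀ a₁ a₂ = numerator m γ β x j a₀ a₁ a₂ := by
  unfold numerator
  ring

lemma Pfun_congr {β γ : ℕ → ℝ} (h : ∀ r ≤ m, β r = γ r) (x : Fin m → ℝ) :
    Pfun m β x = Pfun m γ x := by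
  rw [Pfun_eq_multiaffine, Pfun_eq_multiaffine]
  exact multiaffine_congr (by simpa using h) fun _ _ => rfl

lemma dPfun_congr {β γ : ℕ → ℝ} (h : ∀ r ≤ m, β r = γ r) (x : Fin m → ℝ) (j : Fin m) :
    dPfun m β x j = dPfun m γ x j :=
  Finset.sum_congr rfl fun r hr => by rw [h (r + 1) (Finset.mem_range.1 hr)]

lemma Pfun_add_mul (β γ : ℕ → ℝ) (c : ℝ) (x : Fin m → ℝ) :
    Pfun m (fun r => β r + c * γ r) x = Pfun m β x + c * Pfun m γ x := by
  simp only [Pfun_eq_multiaffine, multiaffine_add_mul]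

lemma dPfun_add_mul (β γ : ℕ → ℝ) (c : ℝ) (x : Fin m → ℝ) (j : Fin m) :
    dPfun m (fun r => β r + c * γ r) x j = dPfun m β x j + c * dPfun m γ x j := by
  simp only [dPfun_eq_multiaffine]
  exact multiaffine_add_mul _ _ c x

lemma numerator_add_mul (β β' γ : ℕ → ℝ) (c : ℝ) (x : Fin m → ℝ) (j : Fin m) (a₀ a₁ a₂ : ℝ) :
    numerator m (fun r => β r + c * β' r) γ x j a₀ a₁ a₂
      = numerator m β γ x j a₀ a₁ a₂ + c * numerator m β' γ x j a₀ a₁ a₂ := by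
  simp only [numerator, Pfun_add_mul, dPfun_add_mul]
  ring

lemma Pfun_pow (c : ℝ) (x : Fin m → ℝ) :
    Pfun m (fun r => (-c) ^ (m - r)) x = ∏ i, (x i - c) := by
  rw [Pfun_eq_multiaffine]
  simpa [sub_eq_add_neg] using multiaffine_pow (S := Finset.univ) (-c) x

lemma dPfun_pow (c : ℝ) (x : Fin m → ℝ) (j : Fin m) :
    dPfun m (fun r => (-c) ^ (m - r)) x j = ∏ i ∈ Finset.univ.erase j, (x i - c) := by
  have h := multiaffine_pow (S := Finset.univ.erase j) (-c) x
  simp only [← sub_eq_add_neg] at h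
  rw [dPfun_eq_multiaffine, ← h]
  refine multiaffine_congr (fun r _ => ?_) fun _ _ => rfl
  rw [Finset.card_erase_of_mem (Finset.mem_univ j), Finset.card_univ, Fintype.card_fin,
    Nat.sub_sub, add_comm]

lemma coeff_eq_sum_div_Delta {x : Fin m → ℝ} (hx : Function.Injective x) {c : ℝ}
    (hc : ∀ i, x i ≠ c) {M : ℝ[X]} (hM : M.natDegree ≤ m) :
    M.coeff m = M.eval c / ∏ i, (c - x i) + ∑ i, M.eval (x i) / ((x i - c) * Delta x i) := by
  have hinj : Function.Injective (fun o : Option (Fin m) => o.elim c x) := by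
    rintro (_ | i) (_ | j) h
    · rfl
    · exact absurd h.symm (hc j)
    · exact absurd h (hc i)
    · exact congrArg some (hx h)
  have h := Lagrange.coeff_eq_sum (s := Finset.univ) hinj.injOn (P := M)
    (lt_of_le_of_lt degree_le_natDegree (by
      rw [Finset.card_univ, Fintype.card_option, Fintype.card_fin]
      exact_mod_cast Nat.lt_succ_of_le hM))
  have hsome (i : Fin m) : (Finset.univ : Finset (Option (Fin m))).erase (some i)
      = Finset.insertNone (Finset.univ.erase i) := by
    ext (_ | j) <;> simp
  have hnone : (Finset.univ : Finset (Option (Fin m))).erase none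
      = Finset.univ.map Function.Embedding.some := by
    ext (_ | j) <;> simp
  simpa [Fintype.sum_option, hsome, hnone, Finset.prod_insertNone, Delta] using h

/-- The numerator of the extremality equation for the factorized polarization, as a
polynomial in `x_j`. -/
def factorizedNumerator (m : ℕ) (c d : ℝ) (Υ : ℝ[X]) : ℝ[X] :=
  (X - C c) * (X - C d) * derivative (derivative Υ)
    - C ((m : ℝ) + 1) * (2 * X - C c - C d) * derivative Υ
    + C (((m : ℝ) + 1) * ((m : ℝ) + 2)) * Υ

lemma natDegree_factorizedNumerator_le (hm : 0 < m) (c d : ℝ) {Υ : ℝ[X]}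
    (hΥ : Υ.natDegree ≤ m + 2) :
    (factorizedNumerator m c d Υ).natDegree ≤ m := by
  rw [natDegree_le_iff_coeff_eq_zero]
  intro k hk
  have hexp : factorizedNumerator m c d Υ = derivative (derivative Υ) * X * X
      - C (c + d) * (derivative (derivative Υ) * X) + C (c * d) * derivative (derivative Υ)
      - C (2 * ((m : ℝ) + 1)) * (derivative Υ * X) + C (((m : ℝ) + 1) * (c + d)) * derivative Υ
      + C (((m : ℝ) + 1) * ((m : ℝ) + 2)) * Υ := by
    simp only [factorizedNumerator, map_add, map_mul, map_one, map_ofNat]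
    ring
  have hz (l : ℕ) (hl : m + 2 < l) : Υ.coeff l = 0 := coeff_eq_zero_of_natDegree_lt (by omega)
  obtain ⟨k, rfl⟩ : ∃ l, k = l + 1 := ⟨k - 1, by omega⟩
  rw [hexp]
  rcases k with _ | k
  · omega
  · simp only [coeff_add, coeff_sub, coeff_C_mul, coeff_mul_X, coeff_derivative]
    rw [hz (k + 1 + 1 + 1 + 1) (by omega)]
    push_cast
    rcases Nat.lt_or_ge (m + 2) (k + 2) with h | h
    · rw [hz _ h, hz (k + 3) (by omega)]
      ring
    · rcases Nat.lt_or_ge (m + 2) (k + 3) with h' | h'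
      · rw [hz (k + 3) h']
        obtain rfl : k = m := by omega
        ring
      · obtain rfl : m = k + 1 := by omega
        push_cast
        ring

end Numerator

section Sufficiency

variable {m : ℕ}

lemma sum_numerator_pow (hm : 0 < m) {x : Fin m → ℝ} (hx : Function.Injective x) {c d : ℝ}
    (hcd : c ≠ d) (hc : ∀ i, x i ≠ c) (hd : ∀ i, x i ≠ d) {Υ : ℝ[X]}
    (hΥ : Υ.natDegree ≤ m + 2) :
    ∑ j, numerator m (fun r => (-c) ^ (m - r)) (fun r => (-d) ^ (m - r)) x j (Υ.eval (x j))
        ((derivative Υ).eval (x j)) ((derivative (derivative Υ)).eval (x j)) / Delta x j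
      = (-1) ^ m / (c - d) * ((factorizedNumerator m c d Υ).eval d * ∏ i, (x i - c)
        - (factorizedNumerator m c d Υ).eval c * ∏ i, (x i - d)) := by
  set M := factorizedNumerator m c d Υ with hMdef
  have hM : M.natDegree ≤ m := natDegree_factorizedNumerator_le hm c d hΥ
  have hEne {e : ℝ} (he : ∀ i, x i ≠ e) : ∏ i, (x i - e) ≠ 0 :=
    Finset.prod_ne_zero_iff.2 fun i _ => sub_ne_zero.2 (he i)
  have hneg (e : ℝ) : ∏ i, (e - x i) = (-1) ^ m * ∏ i, (x i - e) := by
    rw [show (-1 : ℝ) ^ m = ∏ _i : Fin m, (-1 : ℝ) by simp, ← Finset.prod_mul_distrib]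
    exact Finset.prod_congr rfl fun i _ => by ring
  have herase (e : ℝ) (he : ∀ i, x i ≠ e) (j : Fin m) :
      ∏ i ∈ Finset.univ.erase j, (x i - e) = (∏ i, (x i - e)) / (x j - e) := by
    rw [eq_div_iff (sub_ne_zero.2 (he j)), Finset.prod_erase_mul _ _ (Finset.mem_univ j)]
  have hsq : ((-1 : ℝ) ^ m) * (-1) ^ m = 1 := by rw [← mul_pow]; simp
  have hterm (j : Fin m) : numerator m (fun r => (-c) ^ (m - r)) (fun r => (-d) ^ (m - r)) x j
      (Υ.eval (x j)) ((derivative Υ).eval (x j)) ((derivative (derivative Υ)).eval (x j))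
        / Delta x j = (∏ i, (x i - c)) * (∏ i, (x i - d)) / (c - d) *
        (M.eval (x j) / ((x j - c) * Delta x j) - M.eval (x j) / ((x j - d) * Delta x j)) := by
    have h1 := sub_ne_zero.2 (hc j)
    have h2 := sub_ne_zero.2 (hd j)
    have h3 := Delta_ne_zero hx j
    have h4 := sub_ne_zero.2 hcd
    rw [numerator, Pfun_pow, Pfun_pow, dPfun_pow, dPfun_pow, herase c hc, herase d hd, hMdef,
      factorizedNumerator]
    simp only [eval_add, eval_sub, eval_mul, eval_C, eval_X, eval_ofNat]
    field_simp
    ring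
  rw [Finset.sum_congr rfl fun j _ => hterm j, ← Finset.mul_sum, Finset.sum_sub_distrib]
  have hcs := coeff_eq_sum_div_Delta hx hc hM
  have hds := coeff_eq_sum_div_Delta hx hd hM
  rw [hcs, add_comm, ← sub_eq_sub_iff_add_eq_add] at hds
  rw [hneg, hneg] at hds
  have hEc := hEne hc
  have hEd := hEne hd
  have hs : (-1 : ℝ) ^ m ≠ 0 := pow_ne_zero _ (by norm_num)
  rw [hds]
  field_simp
  linear_combination (M.eval d * ∏ i, (x i - c) - M.eval c * ∏ i, (x i - d)) * (-hsq)

lemma exists_sum_pow_eq {c : Fin (m + 1) → ℝ} (hc : Function.Injective c) (β : ℕ → ℝ) :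
    ∃ t : Fin (m + 1) → ℝ, ∀ r ≤ m, β r = ∑ l, t l * (-c l) ^ (m - r) := by
  have hdet : IsUnit (Matrix.vandermonde fun l => -c l) := by
    rw [Matrix.isUnit_iff_isUnit_det, isUnit_iff_ne_zero, Matrix.det_vandermonde_ne_zero_iff]
    exact neg_injective.comp hc
  obtain ⟨t, ht⟩ := Matrix.vecMul_surjective_iff_isUnit.2 hdet fun k => β (m - k)
  refine ⟨t, fun r hr => ?_⟩
  have h := congrFun ht ⟨m - r, by omega⟩
  simp only [Matrix.vecMul, dotProduct, Matrix.vandermonde_apply, Nat.sub_sub_self hr] at h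
  exact h.symm

/-- A class of sequences that is closed under linear combinations, and only depends on the
entries of index at most `m`, is everything once it contains `m + 1` geometric sequences. -/
lemma induction_pow {c : Fin (m + 1) → ℝ} (hc : Function.Injective c) {p : (ℕ → ℝ) → Prop}
    (hcongr : ∀ β γ : ℕ → ℝ, (∀ r ≤ m, β r = γ r) → p β → p γ) (hzero : p 0)
    (hadd : ∀ β γ : ℕ → ℝ, ∀ a : ℝ, p β → p γ → p fun r => β r + a * γ r)
    (hpow : ∀ l, p fun r => (-c l) ^ (m - r)) (β : ℕ → ℝ) : p β := by
  obtain ⟨t, ht⟩ := exists_sum_pow_eq hc β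
  refine hcongr (fun r => ∑ l, t l * (-c l) ^ (m - r)) β (fun r hr => (ht r hr).symm) ?_
  induction (Finset.univ : Finset (Fin (m + 1))) using Finset.induction_on with
  | empty => simpa only [Finset.sum_empty] using! hzero
  | insert l s hl ih =>
    convert hadd _ _ (t l) ih (hpow l) using 2 with r
    rw [Finset.sum_insert hl, add_comm]

/-- The left-hand side of the (polarized) extremality equation of the polynomial `Υ` is a
combination of elementary symmetric functions. -/
def IsBalanced (m : ℕ) (Ω : Set (Fin m → ℝ)) (Υ : ℝ[X]) (β γ : ℕ → ℝ) : Prop :=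
  ∃ α : ℕ → ℝ, ∀ x ∈ Ω, ∑ j, numerator m β γ x j (Υ.eval (x j))
    ((derivative Υ).eval (x j)) ((derivative (derivative Υ)).eval (x j)) / Delta x j
      = Pfun m α x

namespace IsBalanced

variable {Ω : Set (Fin m → ℝ)} {Υ : ℝ[X]} {β β' γ : ℕ → ℝ}

lemma symm (h : IsBalanced m Ω Υ β γ) : IsBalanced m Ω Υ γ β := by
  obtain ⟨α, h⟩ := h
  refine ⟨α, fun x hx => ?_⟩
  simp only [← h x hx, numerator_comm γ β]

lemma zero : IsBalanced m Ω Υ 0 γ :=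
  ⟨0, fun x _ => by simp [numerator, Pfun, dPfun]⟩

lemma congr (hβ : ∀ r ≤ m, β r = β' r) (h : IsBalanced m Ω Υ β γ) : IsBalanced m Ω Υ β' γ := by
  obtain ⟨α, h⟩ := h
  refine ⟨α, fun x hx => ?_⟩
  simp only [← h x hx, numerator, Pfun_congr hβ, dPfun_congr hβ]

lemma add_mul (a : ℝ) (h : IsBalanced m Ω Υ β γ) (h' : IsBalanced m Ω Υ β' γ) :
    IsBalanced m Ω Υ (fun r => β r + a * β' r) γ := by
  obtain ⟨α, h⟩ := h
  obtain ⟨α', h'⟩ := h'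
  refine ⟨fun r => α r + a * α' r, fun x hx => ?_⟩
  rw [Pfun_add_mul, ← h x hx, ← h' x hx, Finset.mul_sum, ← Finset.sum_add_distrib]
  exact Finset.sum_congr rfl fun j _ => by rw [numerator_add_mul]; ring

end IsBalanced

lemma isBalanced_of_natDegree_le (hm : 0 < m) {Ω : Set (Fin m → ℝ)} {B : ℝ}
    (hinj : ∀ x ∈ Ω, Function.Injective x) (hB : ∀ x ∈ Ω, ∀ j, x j < B) {Υ : ℝ[X]}
    (hΥ : Υ.natDegree ≤ m + 2) (β γ : ℕ → ℝ) : IsBalanced m Ω Υ β γ := by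
  have hc : Function.Injective fun l : Fin (m + 1) => B + (l : ℕ) := fun k l h => by
    simpa [Fin.ext_iff] using h
  have hd : Function.Injective fun l : Fin (m + 1) => B + (m + 1 + (l : ℕ) : ℕ) :=
    fun k l h => by simpa [Fin.ext_iff] using h
  refine induction_pow hc (p := fun β => IsBalanced m Ω Υ β γ) (fun _ _ => IsBalanced.congr)
    .zero (fun _ _ a => IsBalanced.add_mul a) (fun k => .symm ?_) β
  refine induction_pow hd (p := fun γ => IsBalanced m Ω Υ γ _) (fun _ _ => IsBalanced.congr)
    .zero (fun _ _ a => IsBalanced.add_mul a) (fun l => .symm ?_) γ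
  set c := B + ((k : ℕ) : ℝ)
  set d := B + ((m + 1 + (l : ℕ) : ℕ) : ℝ)
  have hcd : c ≠ d := fun h => by
    have : (k : ℕ) = m + 1 + (l : ℕ) := by exact_mod_cast add_left_cancel h
    omega
  have hlt {e : ℕ} {x : Fin m → ℝ} (hx : x ∈ Ω) (i : Fin m) : x i ≠ B + (e : ℝ) :=
    ((hB x hx i).trans_le (by simp)).ne
  refine ⟨fun r => (-1) ^ m / (c - d) * (factorizedNumerator m c d Υ).eval d * (-c) ^ (m - r)
    + (-1) ^ m / (c - d) * (-(factorizedNumerator m c d Υ).eval c) * (-d) ^ (m - r),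
    fun x hx => ?_⟩
  rw [sum_numerator_pow hm (hinj x hx) hcd (hlt hx) (hlt hx) hΥ, Pfun_add_mul, Pfun_pow]
  have hz := Pfun_add_mul (m := m) 0 (fun r => (-c) ^ (m - r))
    ((-1) ^ m / (c - d) * (factorizedNumerator m c d Υ).eval d) x
  simp only [Pi.zero_apply, zero_add] at hz
  rw [hz, Pfun_pow]
  have : Pfun m 0 x = 0 := by simp [Pfun]
  rw [this]
  ring

end Sufficiency

section Rigidity

/-- Two polynomials satisfying a nontrivial quadratic relation with constant coefficients are
proportional. -/
lemma mul_coeff_comm_of_quadratic {P Q : ℝ[X]} {a b c : ℝ} (hc : c ≠ 0)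
    (h : ∀ y, P.eval y ^ 2 * a + P.eval y * Q.eval y * b + Q.eval y ^ 2 * c = 0) (r q : ℕ) :
    P.coeff r * Q.coeff q = P.coeff q * Q.coeff r := by
  have hsq (y : ℝ) : (2 * c * Q.eval y + b * P.eval y) ^ 2
      = (b ^ 2 - 4 * a * c) * P.eval y ^ 2 := by
    linear_combination 4 * c * h y
  rcases lt_or_ge (b ^ 2 - 4 * a * c) 0 with hδ | hδ
  · have hP : P = 0 := Polynomial.funext fun y => by
      have := sq_nonneg (2 * c * Q.eval y + b * P.eval y)
      rw [hsq] at this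
      have h0 : P.eval y ^ 2 ≤ 0 := by
        by_contra! hpos
        exact absurd this (not_le.2 (mul_neg_of_neg_of_pos hδ hpos))
      simpa using le_antisymm h0 (sq_nonneg _)
    simp [hP]
  · set μ := √(b ^ 2 - 4 * a * c)
    have hμ : μ ^ 2 = b ^ 2 - 4 * a * c := Real.sq_sqrt hδ
    have hpoly : (C (2 * c) * Q + C b * P) ^ 2 = (C μ * P) ^ 2 := Polynomial.funext fun y => by
      simp only [eval_pow, eval_add, eval_mul, eval_C]
      rw [hsq, ← hμ]
      ring
    obtain ⟨l, hl⟩ : ∃ l : ℝ, ∀ k, 2 * c * Q.coeff k = l * P.coeff k := by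
      rcases sq_eq_sq_iff_eq_or_eq_neg.1 hpoly with h1 | h1
      · refine ⟨μ - b, fun k => ?_⟩
        have := congrArg (fun p => coeff p k) h1
        simp only [coeff_add, coeff_C_mul] at this
        linear_combination this
      · refine ⟨-μ - b, fun k => ?_⟩
        have := congrArg (fun p => coeff p k) h1
        simp only [coeff_add, coeff_C_mul, coeff_neg] at this
        linear_combination this
    have h2c : 2 * c ≠ 0 := mul_ne_zero two_ne_zero hc
    refine mul_left_cancel₀ h2c ?_
    linear_combination P.coeff r * hl q - P.coeff q * hl r

lemma coeff_eq_zero_of_infinite_roots {a b c : ℝ} {s : Set ℝ} (hs : s.Infinite)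
    (h : ∀ t ∈ s, a + b * t + c * t ^ 2 = 0) : a = 0 ∧ b = 0 ∧ c = 0 := by
  have hp : (C a + C b * X + C c * X ^ 2 : ℝ[X]) = 0 :=
    eq_of_infinite_eval_eq _ _ (hs.mono fun t ht => by simpa using h t ht)
  refine ⟨?_, ?_, ?_⟩
  · simpa using congrArg (fun p => coeff p 0) hp
  · simpa [coeff_X, coeff_C, coeff_X_pow] using congrArg (fun p => coeff p 1) hp
  · simpa [coeff_X, coeff_C, coeff_X_pow] using congrArg (fun p => coeff p 2) hp

/-- A sequence with vanishing consecutive minors is decomposable. -/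
lemma exists_eq_mul_pow_mul_pow {m : ℕ} (β : ℕ → ℝ)
    (h : ∀ r < m, ∀ q < m, β r * β (q + 1) = β (r + 1) * β q) :
    ∃ t a b : ℝ, ∀ r ≤ m, β r = t * a ^ (m - r) * b ^ r := by
  by_cases h0 : β 0 = 0
  · have hz (r : ℕ) : r < m → β r = 0 := by
      induction r with
      | zero => exact fun _ => h0
      | succ r ih =>
        intro hr
        have h1 := h r (by omega) (r + 1) hr
        rw [ih (by omega), zero_mul] at h1
        exact mul_self_eq_zero.1 h1.symm
    refine ⟨β m, 0, 1, fun r hr => ?_⟩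
    rcases hr.lt_or_eq with hr | rfl
    · rw [hz r hr, zero_pow (by omega)]
      ring
    · simp
  · refine ⟨β 0, 1, β 1 / β 0, fun r => ?_⟩
    induction r with
    | zero => simp
    | succ r ih =>
      intro hr
      have h1 := h 0 (by omega) r hr
      rw [ih (by omega)] at h1
      simp only [one_pow, mul_one] at h1 ⊢
      rw [pow_succ]
      field_simp at h1 ⊢
      linear_combination h1

variable {m : ℕ}

/-- If the derivatives `β r + s * β (r + 1)` of the form `β` are decomposable for infinitely many
`s`, then `β` is decomposable. -/
lemma exists_eq_mul_pow_mul_pow_of_infinite (hm : 3 ≤ m) (β : ℕ → ℝ) {T : Set ℝ}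
    (hT : T.Infinite)
    (h : ∀ s ∈ T, ∀ r < m - 1, ∀ q < m - 1,
      (β r + s * β (r + 1)) * (β (q + 1) + s * β (q + 2))
        = (β (r + 1) + s * β (r + 2)) * (β q + s * β (q + 1))) :
    ∃ t a b : ℝ, ∀ r ≤ m, β r = t * a ^ (m - r) * b ^ r := by
  have key (r : ℕ) (hr : r < m - 1) (q : ℕ) (hq : q < m - 1) :=
    coeff_eq_zero_of_infinite_roots
    (a := β r * β (q + 1) - β (r + 1) * β q)
    (b := β r * β (q + 2) - β (r + 2) * β q)
    (c := β (r + 1) * β (q + 2) - β (r + 2) * β (q + 1)) hT fun s hs => by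
      linear_combination h s hs r hr q hq
  have hends : β 0 * β m = β 1 * β (m - 1) := by
    obtain ⟨k, rfl⟩ : ∃ k, m = k + 3 := ⟨m - 3, by omega⟩
    have h1 := (key 0 (by omega) (k + 1) (by omega)).2.1
    have h2 := (key 0 (by omega) k (by omega)).2.2
    simp only [zero_add] at h1 h2
    rw [show k + 3 - 1 = k + 2 by omega]
    linear_combination h1 - h2
  refine exists_eq_mul_pow_mul_pow β fun r hr q hq => ?_
  rcases Nat.lt_or_ge r (m - 1) with hr' | hr' <;> rcases Nat.lt_or_ge q (m - 1) with hq' | hq'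
  · exact sub_eq_zero.1 (key r hr' q hq').1
  · obtain rfl : q = m - 1 := by omega
    rcases r with _ | r
    · rw [Nat.sub_add_cancel (by omega), zero_add]
      exact hends
    · obtain ⟨k, rfl⟩ : ∃ k, m = k + 3 := ⟨m - 3, by omega⟩
      exact sub_eq_zero.1 (key r (by omega) (k + 1) (by omega)).2.2
  · obtain rfl : r = m - 1 := by omega
    rcases q with _ | q
    · rw [Nat.sub_add_cancel (by omega), zero_add]
      linear_combination -hends
    · obtain ⟨k, rfl⟩ : ∃ k, m = k + 3 := ⟨m - 3, by omega⟩
      exact sub_eq_zero.1 (key (k + 1) (by omega) q (by omega)).2.2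
  · obtain rfl : r = q := by omega
    ring

/-- `f` is a polynomial function of several variables. -/
def IsMvPoly (f : (Fin m → ℝ) → ℝ) : Prop :=
  ∃ p : MvPolynomial (Fin m) ℝ, ∀ x, f x = MvPolynomial.eval x p

namespace IsMvPoly

variable {f g : (Fin m → ℝ) → ℝ}

lemma const (c : ℝ) : IsMvPoly fun _ : Fin m → ℝ => c := ⟨.C c, by simp⟩

lemma apply (i : Fin m) : IsMvPoly fun x : Fin m → ℝ => x i := ⟨.X i, by simp⟩

lemma add (hf : IsMvPoly f) (hg : IsMvPoly g) : IsMvPoly fun x => f x + g x := by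
  obtain ⟨p, hp⟩ := hf
  obtain ⟨q, hq⟩ := hg
  exact ⟨p + q, fun x => by simp [hp, hq]⟩

lemma mul (hf : IsMvPoly f) (hg : IsMvPoly g) : IsMvPoly fun x => f x * g x := by
  obtain ⟨p, hp⟩ := hf
  obtain ⟨q, hq⟩ := hg
  exact ⟨p * q, fun x => by simp [hp, hq]⟩

lemma sub (hf : IsMvPoly f) (hg : IsMvPoly g) : IsMvPoly fun x => f x - g x := by
  simpa [sub_eq_add_neg] using hf.add ((const (-1)).mul hg)

lemma sum {ι : Type*} (s : Finset ι) {f : ι → (Fin m → ℝ) → ℝ} (h : ∀ i, IsMvPoly (f i)) :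
    IsMvPoly fun x => ∑ i ∈ s, f i x := by
  choose p hp using h
  exact ⟨∑ i ∈ s, p i, fun x => by simp [hp]⟩

lemma prod {ι : Type*} (s : Finset ι) {f : ι → (Fin m → ℝ) → ℝ} (h : ∀ i, IsMvPoly (f i)) :
    IsMvPoly fun x => ∏ i ∈ s, f i x := by
  choose p hp using h
  exact ⟨∏ i ∈ s, p i, fun x => by simp [hp]⟩

lemma aeval (p : ℝ[X]) (hf : IsMvPoly f) : IsMvPoly fun x => p.eval (f x) := by
  obtain ⟨q, hq⟩ := hf
  refine ⟨Polynomial.aeval q p, fun x => ?_⟩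
  show p.eval (f x) = _
  rw [hq, ← MvPolynomial.coe_aeval_eq_eval, ← Polynomial.coe_aeval_eq_eval]
  exact Polynomial.aeval_algHom_apply (MvPolynomial.aeval x) q p

lemma multiaffine_comp (S : Finset (Fin m)) (β : ℕ → ℝ) {F : (Fin m → ℝ) → Fin m → ℝ}
    (hF : ∀ i, IsMvPoly fun x => F x i) : IsMvPoly fun x => multiaffine S β (F x) :=
  .sum _ fun _ => .mul (.const _) (.sum _ fun _ => .prod _ hF)

lemma eq_zero (hf : IsMvPoly f) (s : Fin m → Set ℝ) (hs : ∀ i, (s i).Infinite)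
    (h : ∀ x : Fin m → ℝ, (∀ i, x i ∈ s i) → f x = 0) (x : Fin m → ℝ) : f x = 0 := by
  obtain ⟨p, hp⟩ := hf
  have : p = 0 := MvPolynomial.funext_set s hs fun x hx => by
    rw [← hp, h x fun i => hx i trivial, map_zero]
  rw [hp, this, map_zero]

end IsMvPoly

lemma isMvPoly_numerator (β : ℕ → ℝ) (j : Fin m) {F : (Fin m → ℝ) → Fin m → ℝ}
    {a₀ a₁ a₂ : (Fin m → ℝ) → ℝ} (hF : ∀ i, IsMvPoly fun x => F x i) (h₀ : IsMvPoly a₀)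
    (h₁ : IsMvPoly a₁) (h₂ : IsMvPoly a₂) :
    IsMvPoly fun x => numerator m β β (F x) j (a₀ x) (a₁ x) (a₂ x) := by
  simp only [numerator, Pfun_eq_multiaffine, dPfun_eq_multiaffine]
  have hP := IsMvPoly.multiaffine_comp Finset.univ β hF
  have hd := IsMvPoly.multiaffine_comp (Finset.univ.erase j) (fun r => β (r + 1)) hF
  exact .add (.sub (.mul (.mul hP hP) h₂)
    (.mul (.mul (.const _) (.add (.mul hP hd) (.mul hd hP))) h₁))
    (.mul (.mul (.const _) (.mul hd hd)) h₀)

/-- If a nonzero polynomial solves the numerator equation on all diagonals `x i = x j`, then the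
form `β` is decomposable. -/
lemma exists_eq_mul_pow_mul_pow_of_numerator (hm : 3 ≤ m) (β : ℕ → ℝ) {i j : Fin m}
    (hij : i ≠ j) {D : ℝ[X]} (hD : D ≠ 0)
    (h : ∀ x : Fin m → ℝ, x i = x j → numerator m β β x i (D.eval (x i))
      ((derivative D).eval (x i)) ((derivative (derivative D)).eval (x i)) = 0) :
    ∃ t a b : ℝ, ∀ r ≤ m, β r = t * a ^ (m - r) * b ^ r := by
  have hT : {s | D.eval s = 0}ᶜ.Infinite :=
    (Polynomial.finite_setOfPred_isRoot hD).infinite_compl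
  refine exists_eq_mul_pow_mul_pow_of_infinite hm β hT fun s hs r hr q hq => ?_
  let S := (Finset.univ.erase i).erase j
  have hS : S.card = m - 2 := by
    rw [Finset.card_erase_of_mem (by simp [hij.symm]), Finset.card_erase_of_mem (by simp)]
    simp; omega
  let P (γ : ℕ → ℝ) : ℝ[X] :=
    ∑ r ∈ Finset.range (m - 1), monomial r (γ r * ((m - 2).choose r : ℝ))
  have hPcoeff (γ : ℕ → ℝ) (r : ℕ) (hr : r < m - 1) :
      (P γ).coeff r = γ r * ((m - 2).choose r : ℝ) := by
    simp [P, finsetSum_coeff, coeff_monomial, hr]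
  let x (y : ℝ) : Fin m → ℝ := fun k => if k = i ∨ k = j then s else y
  have hxi (y : ℝ) : x y i = s := by simp [x]
  have hxj (y : ℝ) : x y j = s := by simp [x]
  have hmulti (γ : ℕ → ℝ) (y : ℝ) : multiaffine S γ (x y) = (P γ).eval y := by
    rw [multiaffine_congr (fun r _ => rfl) (y := fun _ => y) fun k hk => by
      simp only [S, Finset.mem_erase] at hk
      simp [x, hk.1, hk.2.1], multiaffine, hS, show m - 2 + 1 = m - 1 by omega, eval_finsetSum]
    refine Finset.sum_congr rfl fun r _ => ?_
    rw [esymmOn_const, hS, eval_monomial]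
    ring
  have hd (y : ℝ) : dPfun m β (x y) i = (P fun r => β (r + 1) + s * β (r + 2)).eval y := by
    rw [dPfun_eq_add_mul hij, hxj, ← multiaffine_add_mul, hmulti]
  have hP (y : ℝ) : Pfun m β (x y) =
      (P fun r => β r + s * β (r + 1) + s * (β (r + 1) + s * β (r + 2))).eval y := by
    have hb : multiaffine (Finset.univ.erase i) β (x y)
        = multiaffine S (fun r => β r + s * β (r + 1)) (x y) := by
      rw [← Finset.insert_erase (a := j) (s := Finset.univ.erase i) (by simp [hij.symm]),
        multiaffine_insert (Finset.notMem_erase j _), hxj]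
    rw [Pfun_eq_add_mul_dPfun β _ i, hd, hxi, hb, ← hmulti, ← hmulti]
    exact (multiaffine_add_mul _ _ s _).symm
  have hc : ((m : ℝ) + 1) * ((m : ℝ) + 2) * D.eval s ≠ 0 :=
    mul_ne_zero (by positivity) hs
  have hcomm := mul_coeff_comm_of_quadratic
    (P := P fun r => β r + s * β (r + 1) + s * (β (r + 1) + s * β (r + 2)))
    (Q := P fun r => β (r + 1) + s * β (r + 2)) hc
    (a := (derivative (derivative D)).eval s)
    (b := -(2 * ((m : ℝ) + 1)) * (derivative D).eval s) (fun y => by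
    have h0 := h (x y) (by rw [hxi, hxj])
    rw [numerator_self, hxi, hP, hd] at h0
    linear_combination h0) r q
  simp only [hPcoeff _ r hr, hPcoeff _ q hq] at hcomm
  have hr0 : ((m - 2).choose r : ℝ) ≠ 0 := by
    exact_mod_cast (Nat.choose_pos (by omega)).ne'
  have hq0 : ((m - 2).choose q : ℝ) ≠ 0 := by
    exact_mod_cast (Nat.choose_pos (by omega)).ne'
  refine mul_left_cancel₀ (mul_ne_zero hr0 hq0) ?_
  linear_combination hcomm

end Rigidity

section Extremality

variable {m : ℕ}

lemma deriv_eq_eval_derivative {f : ℝ → ℝ} {Υ : ℝ[X]} {u v : ℝ}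
    (h : ∀ t ∈ Set.Ioo u v, f t = Υ.eval t) :
    ∀ t ∈ Set.Ioo u v, deriv f t = (derivative Υ).eval t := fun t ht => by
  rw [(Filter.eventuallyEq_of_mem (isOpen_Ioo.mem_nhds ht) h).deriv_eq, Polynomial.deriv]

lemma injective_of_mem_of_disjoint {I : Fin m → Set ℝ}
    (hdisj : ∀ i j : Fin m, i ≠ j → Disjoint (I i) (I j)) {x : Fin m → ℝ}
    (hx : ∀ j, x j ∈ I j) : Function.Injective x := fun i j hij => by
  by_contra hne
  exact Set.disjoint_left.1 (hdisj i j hne) (hx i) (hij ▸ hx j)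

lemma isPolyLE_Pfun_update (β : ℕ → ℝ) (x : Fin m → ℝ) (j : Fin m) :
    IsPolyLE 1 fun t => Pfun m β (Function.update x j t) := by
  simp only [Pfun_update]
  exact .affine _ _

lemma isPolyLE_dPfun_update {j k : Fin m} (hk : k ≠ j) (β : ℕ → ℝ) (x : Fin m → ℝ) :
    IsPolyLE 1 fun t => dPfun m β (Function.update x j t) k := by
  simp only [dPfun_eq_add_mul hk, multiaffine_update (Finset.notMem_erase j _),
    Function.update_self]
  exact .affine _ _

lemma isPolyLE_numerator_update {j k : Fin m} (hk : k ≠ j) (β γ : ℕ → ℝ) (x : Fin m → ℝ)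
    (a₀ a₁ a₂ : ℝ) :
    IsPolyLE 2 fun t => numerator m β γ (Function.update x j t) k a₀ a₁ a₂ := by
  have hP (β : ℕ → ℝ) := isPolyLE_Pfun_update β x j
  have hd (β : ℕ → ℝ) := isPolyLE_dPfun_update hk β x
  have h := ((((hP β).mul (hP γ)).const_mul a₂).add
    ((((hP β).mul (hd γ)).add ((hd β).mul (hP γ))).const_mul (-((m : ℝ) + 1) * a₁))).add
    (((hd β).mul (hd γ)).const_mul (((m : ℝ) + 1) * ((m : ℝ) + 2) * a₀))
  convert h using 2 with t
  unfold numerator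
  ring

/-- The numerator of the extremality equation of a polynomial `Υ`, as a polynomial in `x_j`. -/
def numeratorPoly (m : ℕ) (p q : ℝ) (Υ : ℝ[X]) : ℝ[X] :=
  (C p + X * C q) ^ 2 * derivative (derivative Υ)
    - C (2 * ((m : ℝ) + 1)) * (C p + X * C q) * C q * derivative Υ
    + C (((m : ℝ) + 1) * ((m : ℝ) + 2)) * C q ^ 2 * Υ

lemma eval_numeratorPoly (β : ℕ → ℝ) (x : Fin m → ℝ) (j : Fin m) (Υ : ℝ[X]) (t : ℝ) :
    (numeratorPoly m (multiaffine (Finset.univ.erase j) β x) (dPfun m β x j) Υ).eval t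
      = numerator m β β (Function.update x j t) j (Υ.eval t) ((derivative Υ).eval t)
        ((derivative (derivative Υ)).eval t) := by
  rw [numerator_self, Pfun_update, dPfun_update_self]
  simp [numeratorPoly, mul_comm t]

/-- On the product of the intervals, the numerators of an extremal tuple are the values of a
single polynomial of degree at most `m` in each variable. -/
lemma IsExtremalV.exists_polynomial_numerator (hm : 2 ≤ m) {β : ℕ → ℝ} {I : Fin m → Set ℝ}
    (hdisj : ∀ i j : Fin m, i ≠ j → Disjoint (I i) (I j)) {A : Fin m → ℝ → ℝ}
    (h : IsExtremalV m β I A) {x : Fin m → ℝ} (hx : ∀ j, x j ∈ I j) (j : Fin m) :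
    ∃ R : ℝ[X], R.natDegree ≤ m ∧
      (∀ t ∈ I j, numerator m β β (Function.update x j t) j (A j t) (deriv (A j) t)
        (deriv (deriv (A j)) t) = R.eval t) ∧
      ∀ i ≠ j, numerator m β β (Function.update x j (x i)) i (A i (x i)) (deriv (A i) (x i))
        (deriv (deriv (A i)) (x i)) = R.eval (x i) := by
  obtain ⟨α, hα⟩ := h
  have hupd (t : ℝ) (ht : t ∈ I j) : ∀ k, Function.update x j t k ∈ I k := fun k => by
    rcases eq_or_ne k j with rfl | hk
    · simpa using ht
    · simpa [hk] using hx k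
  let n (k : Fin m) (t : ℝ) : ℝ := numerator m β β (Function.update x j t) k
    (A k (Function.update x j t k)) (deriv (A k) (Function.update x j t k))
    (deriv (deriv (A k)) (Function.update x j t k))
  obtain ⟨R, hR, h1, h2⟩ := _root_.exists_polynomial_numerator hm j (T := I j) (n := n)
    (fun t ht => injective_of_mem_of_disjoint hdisj (hupd t ht))
    (injective_of_mem_of_disjoint hdisj hx)
    (fun k hk => by
      simp only [n, Function.update_of_ne hk]
      exact isPolyLE_numerator_update hk β β x _ _ _)
    (isPolyLE_Pfun_update α x j)
    (fun t ht => by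
      simp only [n, numerator_self]
      exact hα _ (hupd t ht))
  refine ⟨R, hR, fun t ht => ?_, fun i hi => ?_⟩
  · simpa [n] using h1 t ht
  · simpa [n, hi] using h2 i hi

/-- Each member of an extremal tuple is a polynomial of degree at most `m + 2`. -/
lemma IsExtremalV.exists_polynomial (hm : 2 ≤ m) {β : ℕ → ℝ} {I : Fin m → Set ℝ}
    (hI : ∀ j, ∃ u v : ℝ, u < v ∧ I j = Set.Ioo u v)
    (hdisj : ∀ i j : Fin m, i ≠ j → Disjoint (I i) (I j)) {A : Fin m → ℝ → ℝ}
    (hA : ∀ j, ContDiffOn ℝ (⊤ : ℕ∞) (A j) (I j))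
    (hP : ∀ x : Fin m → ℝ, (∀ j, x j ∈ I j) → Pfun m β x ≠ 0)
    (h : IsExtremalV m β I A) (j : Fin m) :
    ∃ Υ : ℝ[X], Υ.natDegree ≤ m + 2 ∧ ∀ t ∈ I j, A j t = Υ.eval t := by
  have hne (k : Fin m) : (I k).Nonempty := by
    obtain ⟨u, v, huv, hk⟩ := hI k
    exact hk ▸ Set.nonempty_Ioo.2 huv
  choose x hx using hne
  obtain ⟨R, hR, hRj, -⟩ := h.exists_polynomial_numerator hm hdisj hx j
  obtain ⟨u, v, huv, hj⟩ := hI j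
  have hAj := hA j
  rw [hj] at hRj hAj ⊢
  refine exists_polynomial_of_numerator m (multiaffine (Finset.univ.erase j) β x)
    (dPfun m β x j) (fun k => deriv^[k] (A j)) (hasDerivAt_iterate_deriv hAj)
    (fun t ht => ?_) hR fun t ht => ?_
  · rw [← Pfun_update]
    refine hP _ fun k => ?_
    rcases eq_or_ne k j with rfl | hk
    · simpa [hj] using ht
    · simpa [hk] using hx k
  · rw [← hRj t ht, numerator_self, Pfun_update, dPfun_update_self]
    rfl

/-- If the form `β` is indecomposable, all members of an extremal tuple are restrictions of the
same polynomial. -/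
lemma IsExtremalV.eq_of_indecomposable (hm : 3 ≤ m) {β : ℕ → ℝ} {I : Fin m → Set ℝ}
    (hI : ∀ j, ∃ u v : ℝ, u < v ∧ I j = Set.Ioo u v)
    (hdisj : ∀ i j : Fin m, i ≠ j → Disjoint (I i) (I j)) {A : Fin m → ℝ → ℝ}
    (hind : ¬ ∃ t a b : ℝ, ∀ r ≤ m, β r = t * a ^ (m - r) * b ^ r)
    (h : IsExtremalV m β I A) {Υ : Fin m → ℝ[X]}
    (hΥ : ∀ j, ∀ t ∈ I j, A j t = (Υ j).eval t) (i j : Fin m) : Υ i = Υ j := by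
  by_cases hij : i = j
  · rw [hij]
  have hinf (k : Fin m) : (I k).Infinite := by
    obtain ⟨u, v, huv, hk⟩ := hI k
    exact hk ▸ Set.Ioo_infinite huv
  have hΥ' (k : Fin m) : ∀ t ∈ I k, deriv (A k) t = (derivative (Υ k)).eval t := by
    obtain ⟨u, v, -, hk⟩ := hI k
    have hk' := hΥ k
    rw [hk] at hk' ⊢
    exact deriv_eq_eval_derivative hk'
  have hΥ'' (k : Fin m) :
      ∀ t ∈ I k, deriv (deriv (A k)) t = (derivative (derivative (Υ k))).eval t := by
    obtain ⟨u, v, -, hk⟩ := hI k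
    have hk' := hΥ' k
    rw [hk] at hk' ⊢
    exact deriv_eq_eval_derivative hk'
  by_contra hne
  refine hind (exists_eq_mul_pow_mul_pow_of_numerator hm β hij (sub_ne_zero.2 hne) ?_)
  have hF (k : Fin m) : IsMvPoly fun x : Fin m → ℝ => Function.update x j (x i) k := by
    rcases eq_or_ne k j with rfl | hk
    · simpa using IsMvPoly.apply i
    · simpa [hk] using IsMvPoly.apply k
  have hzero := (isMvPoly_numerator β i hF ((IsMvPoly.apply i).aeval (Υ i - Υ j))
    ((IsMvPoly.apply i).aeval (derivative (Υ i - Υ j)))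
    ((IsMvPoly.apply i).aeval (derivative (derivative (Υ i - Υ j))))).eq_zero I hinf
    fun x hx => by
      obtain ⟨R, -, hRj, hRi⟩ := h.exists_polynomial_numerator (by omega) hdisj hx j
      have hR : numeratorPoly m (multiaffine (Finset.univ.erase j) β x) (dPfun m β x j) (Υ j)
          = R := eq_of_infinite_eval_eq _ _ ((hinf j).mono fun t ht => by
        show eval t _ = _
        rw [eval_numeratorPoly, ← hRj t ht, hΥ j t ht, hΥ' j t ht, hΥ'' j t ht])
      have h1 := hRi i hij
      rw [← hR, eval_numeratorPoly, hΥ i _ (hx i), hΥ' i _ (hx i), hΥ'' i _ (hx i),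
        numerator_self, numerator_self,
        ← dPfun_eq_of_eq β (x := Function.update x j (x i)) (i := i) (j := j)
          (by simp [hij])] at h1
      simp only [numerator_self, derivative_sub, eval_sub]
      linear_combination h1
  intro x hx
  have h0 := hzero x
  rwa [hx, Function.update_eq_self, ← hx] at h0

/-- The restrictions of a polynomial of degree at most `m + 2` form an extremal tuple. -/
lemma isExtremalV_of_polynomial (hm : 0 < m) {β : ℕ → ℝ} {I : Fin m → Set ℝ}
    (hI : ∀ j, ∃ u v : ℝ, u < v ∧ I j = Set.Ioo u v)
    (hdisj : ∀ i j : Fin m, i ≠ j → Disjoint (I i) (I j)) {A : Fin m → ℝ → ℝ} {Υ : ℝ[X]}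
    (hΥ : Υ.natDegree ≤ m + 2) (hA : ∀ j, ∀ t ∈ I j, A j t = Υ.eval t) :
    IsExtremalV m β I A := by
  choose u v huv hI using hI
  simp only [hI] at hA
  obtain ⟨B, hB⟩ := (Finset.univ.image v).exists_le
  obtain ⟨α, hα⟩ := isBalanced_of_natDegree_le hm (Ω := {x | ∀ j, x j ∈ I j}) (B := B)
    (fun x hx => injective_of_mem_of_disjoint hdisj hx)
    (fun x hx j => by
      have hxj := hx j
      rw [hI] at hxj
      exact hxj.2.trans_le (hB _ (Finset.mem_image_of_mem v (Finset.mem_univ j)))) hΥ β β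
  refine ⟨α, fun x hx => (Finset.sum_congr rfl fun j _ => ?_).trans (hα x hx)⟩
  have hxj := hx j
  rw [hI] at hxj
  have hA' := deriv_eq_eval_derivative (hA j)
  rw [hA j _ hxj, hA' _ hxj, deriv_eq_eval_derivative hA' _ hxj, numerator_self]

end Extremality

/-- for `m ≥ 3`, if there are no reals `t, a, b` with
`β_r = t·a^(m−r)·b^r` for all `r = 0,…,m` (the defining element of the Veronese structure
is indecomposable), then `(A₁,…,A_m)` is extremal iff all the `A_j` agree on their
intervals with one single polynomial `Υ` of degree at most `m + 2`. -/
theorem statement2 (m : ℕ) (hm : 3 ≤ m)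
    (β : ℕ → ℝ) (hβ : ∃ r ≤ m, β r ≠ 0)
    (I : Fin m → Set ℝ)
    (hI : ∀ j, ∃ u v : ℝ, u < v ∧ I j = Set.Ioo u v)
    (hdisj : ∀ i j : Fin m, i ≠ j → Disjoint (I i) (I j))
    (A : Fin m → ℝ → ℝ) (hA : ∀ j, ContDiffOn ℝ (⊤ : ℕ∞) (A j) (I j))
    (hP : ∀ x : Fin m → ℝ, (∀ j, x j ∈ I j) → Pfun m β x ≠ 0)
    (hind : ¬ ∃ t a b : ℝ, ∀ r ≤ m, β r = t * a ^ (m - r) * b ^ r) :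
    IsExtremalV m β I A ↔
      ∃ Υ : Polynomial ℝ, Υ.natDegree ≤ m + 2 ∧
        ∀ j : Fin m, ∀ x ∈ I j, A j x = Υ.eval x := by
  refine ⟨fun h => ?_, fun ⟨Υ, hΥ, hAΥ⟩ => isExtremalV_of_polynomial (by omega) hI hdisj hΥ hAΥ⟩
  choose Υ hΥ hAΥ using h.exists_polynomial (by omega) hI hdisj hA hP
  let k : Fin m := ⟨0, by omega⟩
  refine ⟨Υ k, hΥ k, fun j x hx => ?_⟩
  rw [h.eq_of_indecomposable hm hI hdisj hind hAΥ k j]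
  exact hAΥ j x hx

end
end

section
/- Assume m = 2, β₁ ≠ 0 and β₂ ≠ 0. Then (A₁,A₂) is extremal if and only if there are real numbers a_{jr} (j = 1,2; r = 0,…,4) such that A_j(x) = ∑_{r=0}^4 a_{jr} x^r on I_j for j = 1,2, and the coefficients satisfy the three relations: a_{24} = −(β₂²/β₁²)·a_{14}; a_{23} = −4(β₀β₂/β₁²)·a_{14} + (β₂/β₁)·a_{13}; a_{22} = −6(β₀²/β₁²)·a_{14} + 3(β₀/β₁)·a_{13} − a_{12} (with a_{10},…,a_{14}, a_{20}, a_{21} arbitrary). -/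
noncomputable section

/-- `P(x) = β₀ + ∑_{j=1}^m β_j x_j`. -/
def PS (m : ℕ) (β0 : ℝ) (β : Fin m → ℝ) (x : Fin m → ℝ) : ℝ :=
  β0 + ∑ j : Fin m, β j * x j

/-- The extremality equation of the twisted product of Riemann surfaces (the separable
Kähler geometry associated with the product Segre factorization structure), with
denominators cleared: there are reals `α₀, α₁, …, α_m` such that on `Ω = I₁ × ⋯ × I_m`,
`∑_j [P² A_j'' − 2(m+1) β_j P A_j' + (m+1)(m+2) β_j² A_j] = α₀ + ∑_j α_j x_j`. -/
def IsExtremalS (m : ℕ) (β0 : ℝ) (β : Fin m → ℝ) (I : Fin m → Set ℝ)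
    (A : Fin m → ℝ → ℝ) : Prop :=
  ∃ (α0 : ℝ) (α : Fin m → ℝ), ∀ x : Fin m → ℝ, (∀ j, x j ∈ I j) →
    (∑ j : Fin m,
      ((PS m β0 β x) ^ 2 * deriv (deriv (A j)) (x j)
        - 2 * ((m : ℝ) + 1) * β j * PS m β0 β x * deriv (A j) (x j)
        + ((m : ℝ) + 1) * ((m : ℝ) + 2) * β j ^ 2 * A j (x j)))
    = α0 + ∑ j : Fin m, α j * x j

/-- A smooth function on an open set has a smooth derivative there. -/
theorem ContDiffOn.hasDerivAt_and_contDiffOn_deriv {f : ℝ → ℝ} {s : Set ℝ} (hs : IsOpen s)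
    (hf : ContDiffOn ℝ (⊤ : ℕ∞) f s) :
    (∀ x ∈ s, HasDerivAt f (deriv f x) x) ∧ ContDiffOn ℝ (⊤ : ℕ∞) (deriv f) s := by
  refine ⟨fun x hx => ?_, ((contDiffOn_infty_iff_deriv_of_isOpen hs).1 hf).2⟩
  exact (((contDiffOn_infty_iff_deriv_of_isOpen hs).1 hf).1.differentiableAt
    (hs.mem_nhds hx)).hasDerivAt

/-- Two functions that agree on an open set have the same derivatives there. -/
theorem HasDerivAt.unique_of_eqOn {f g : ℝ → ℝ} {s : Set ℝ} (hs : IsOpen s)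
    (h : ∀ x ∈ s, f x = g x) {x f' g' : ℝ} (hx : x ∈ s)
    (hf : HasDerivAt f f' x) (hg : HasDerivAt g g' x) : f' = g' :=
  hf.unique (hg.congr_of_eventuallyEq (Filter.eventuallyEq_of_mem (hs.mem_nhds hx) h))

/-- Functions with the same derivative on an open interval differ by a constant. -/
theorem exists_eq_add_const_of_hasDerivAt {f g f' : ℝ → ℝ} {s : Set ℝ} (hs : IsOpen s)
    (hc : IsPreconnected s) (hf : ∀ x ∈ s, HasDerivAt f (f' x) x)
    (hg : ∀ x ∈ s, HasDerivAt g (f' x) x) : ∃ k, ∀ x ∈ s, f x = g x + k := by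
  obtain ⟨k, hk⟩ := hs.exists_eq_add_of_deriv_eq hc
    (fun x hx => (hf x hx).differentiableAt.differentiableWithinAt)
    (fun x hx => (hg x hx).differentiableAt.differentiableWithinAt)
    (fun x hx => (hf x hx).deriv.trans (hg x hx).deriv.symm)
  exact ⟨k, hk⟩

/-- The derivative of a real quartic. -/
theorem hasDerivAt_quartic (a b c d e x : ℝ) :
    HasDerivAt (fun x : ℝ => a + b * x + c * x ^ 2 + d * x ^ 3 + e * x ^ 4)
      (b + 2 * c * x + 3 * d * x ^ 2 + 4 * e * x ^ 3) x := by
  have h := (((((hasDerivAt_id x).const_mul b).const_add a).add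
    ((hasDerivAt_pow 2 x).const_mul c)).add ((hasDerivAt_pow 3 x).const_mul d)).add
    ((hasDerivAt_pow 4 x).const_mul e)
  refine (h.congr_deriv ?_)
  norm_num
  ring

/-- A function with constant fourth derivative on an open interval is a quartic. -/
theorem exists_quartic_of_hasDerivAt_const {f f1 f2 f3 : ℝ → ℝ} {s : Set ℝ} (hs : IsOpen s)
    (hc : IsPreconnected s) {k : ℝ} (h0 : ∀ x ∈ s, HasDerivAt f (f1 x) x)
    (h1 : ∀ x ∈ s, HasDerivAt f1 (f2 x) x) (h2 : ∀ x ∈ s, HasDerivAt f2 (f3 x) x)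
    (h3 : ∀ x ∈ s, HasDerivAt f3 k x) :
    ∃ c : Fin 5 → ℝ, k = 24 * c 4 ∧ ∀ x ∈ s,
      f x = c 0 + c 1 * x + c 2 * x ^ 2 + c 3 * x ^ 3 + c 4 * x ^ 4 ∧
      f2 x = 2 * c 2 + 6 * c 3 * x + 12 * c 4 * x ^ 2 ∧
      f3 x = 6 * c 3 + 24 * c 4 * x := by
  obtain ⟨d, hd⟩ := exists_eq_add_const_of_hasDerivAt (f' := fun _ => k) hs hc h3
    (fun x _ => (hasDerivAt_quartic 0 k 0 0 0 x).congr_deriv (by ring))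
  obtain ⟨c, hc2⟩ := exists_eq_add_const_of_hasDerivAt hs hc h2
    (fun x hx => (hasDerivAt_quartic 0 d (k / 2) 0 0 x).congr_deriv (by rw [hd x hx]; ring))
  obtain ⟨b, hb⟩ := exists_eq_add_const_of_hasDerivAt hs hc h1
    (fun x hx => (hasDerivAt_quartic 0 c (d / 2) (k / 6) 0 x).congr_deriv
      (by rw [hc2 x hx]; ring))
  obtain ⟨a, ha⟩ := exists_eq_add_const_of_hasDerivAt hs hc h0
    (fun x hx => (hasDerivAt_quartic 0 b (c / 2) (d / 6) (k / 24) x).congr_deriv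
      (by rw [hb x hx]; ring))
  refine ⟨![a, b, c / 2, d / 6, k / 24], ?_, fun x hx => ⟨?_, ?_, ?_⟩⟩
  · simp; ring
  · rw [ha x hx]; simp; ring
  · rw [hc2 x hx]; simp; ring
  · rw [hd x hx]; simp; ring

/-- Repeated differentiation of the two-variable extremality equation. -/
theorem fourth_deriv_relations {b0 b1 b2 α0 α1 α2 : ℝ} {U V : Set ℝ}
    (hU : IsOpen U) (hV : IsOpen V) {f f1 f2 f3 f4 g g1 g2 g3 g4 : ℝ → ℝ}
    (hf : ∀ x ∈ U, HasDerivAt f (f1 x) x) (hf1 : ∀ x ∈ U, HasDerivAt f1 (f2 x) x)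
    (hf2 : ∀ x ∈ U, HasDerivAt f2 (f3 x) x) (hf3 : ∀ x ∈ U, HasDerivAt f3 (f4 x) x)
    (hg1 : ∀ y ∈ V, HasDerivAt g1 (g2 y) y) (hg2 : ∀ y ∈ V, HasDerivAt g2 (g3 y) y)
    (hg3 : ∀ y ∈ V, HasDerivAt g3 (g4 y) y)
    (h : ∀ x ∈ U, ∀ y ∈ V, (b0 + b1 * x + b2 * y) ^ 2 * (f2 x + g2 y)
      - 6 * (b0 + b1 * x + b2 * y) * (b1 * f1 x + b2 * g1 y)
      + 12 * (b1 ^ 2 * f x + b2 ^ 2 * g y) = α0 + α1 * x + α2 * y) :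
    ∀ x ∈ U, ∀ y ∈ V,
      (b0 + b1 * x + b2 * y) * (b2 * f3 x + b1 * g3 y) = 2 * b1 * b2 * (f2 x + g2 y) ∧
      (b0 + b1 * x + b2 * y) * (b2 * f4 x) = b1 * (b2 * f3 x - b1 * g3 y) ∧
      b2 ^ 2 * f4 x = - b1 ^ 2 * g4 y := by
  have dPx (x y : ℝ) : HasDerivAt (fun x => b0 + b1 * x + b2 * y) b1 x := by
    simpa using (((hasDerivAt_id x).const_mul b1).const_add b0).add_const (b2 * y)
  have dPy (x y : ℝ) : HasDerivAt (fun y => b0 + b1 * x + b2 * y) b2 y := by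
    simpa using ((hasDerivAt_id y).const_mul b2).const_add (b0 + b1 * x)
  have hx : ∀ x ∈ U, ∀ y ∈ V, (b0 + b1 * x + b2 * y) ^ 2 * f3 x
      + (b0 + b1 * x + b2 * y) * (2 * b1 * g2 y - 4 * b1 * f2 x)
      + 6 * b1 * (b1 * f1 x - b2 * g1 y) = α1 := by
    intro x hx y hy
    have hl := ((((dPx x y).fun_pow 2).fun_mul ((hf2 x hx).add_const (g2 y))).fun_sub
      (((dPx x y).const_mul 6).fun_mul (((hf1 x hx).const_mul b1).add_const (b2 * g1 y)))).fun_add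
      ((((hf x hx).const_mul (b1 ^ 2)).add_const (b2 ^ 2 * g y)).const_mul 12)
    have hr := (((hasDerivAt_id' x).const_mul α1).const_add α0).add_const (α2 * y)
    have := HasDerivAt.unique_of_eqOn hU (fun x hx => h x hx y hy) hx hl hr
    norm_num at this
    linear_combination this
  have hxy : ∀ x ∈ U, ∀ y ∈ V,
      (b0 + b1 * x + b2 * y) * (b2 * f3 x + b1 * g3 y) = 2 * b1 * b2 * (f2 x + g2 y) := by
    intro x hx' y hy
    have hl := ((((dPy x y).fun_pow 2).mul_const (f3 x)).fun_add
      ((dPy x y).fun_mul (((hg2 y hy).const_mul (2 * b1)).sub_const (4 * b1 * f2 x)))).fun_add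
      ((((hg1 y hy).const_mul b2).const_sub (b1 * f1 x)).const_mul (6 * b1))
    have := HasDerivAt.unique_of_eqOn hV (fun y hy => hx x hx' y hy) hy hl
      (hasDerivAt_const y α1)
    norm_num at this
    linear_combination this / 2
  have hxxy : ∀ x ∈ U, ∀ y ∈ V,
      (b0 + b1 * x + b2 * y) * (b2 * f4 x) = b1 * (b2 * f3 x - b1 * g3 y) := by
    intro x hx' y hy
    have hl := (dPx x y).fun_mul (((hf3 x hx').const_mul b2).add_const (b1 * g3 y))
    have hr := ((hf2 x hx').add_const (g2 y)).const_mul (2 * b1 * b2)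
    have := HasDerivAt.unique_of_eqOn hU (fun x hx => hxy x hx y hy) hx' hl hr
    linear_combination this
  refine fun x hx' y hy => ⟨hxy x hx' y hy, hxxy x hx' y hy, ?_⟩
  have hl := (dPy x y).mul_const (b2 * f4 x)
  have hr := (((hg3 y hy).const_mul b1).const_sub (b2 * f3 x)).const_mul b1
  have := HasDerivAt.unique_of_eqOn hV (fun y hy => hxxy x hx' y hy) hy hl hr
  linear_combination this

/-- Derivatives of a function that is a quartic on an open set. -/
theorem deriv_of_eqOn_quartic {f : ℝ → ℝ} {s : Set ℝ} (hs : IsOpen s) {a b c d e : ℝ}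
    (h : ∀ x ∈ s, f x = a + b * x + c * x ^ 2 + d * x ^ 3 + e * x ^ 4) :
    ∀ x ∈ s, deriv f x = b + 2 * c * x + 3 * d * x ^ 2 + 4 * e * x ^ 3 := fun x hx =>
  ((hasDerivAt_quartic a b c d e x).congr_of_eventuallyEq
    (Filter.eventuallyEq_of_mem (hs.mem_nhds hx) h)).deriv

/-- `m = 2`, `β₁ ≠ 0`, `β₂ ≠ 0`. Then `(A₁,A₂)` is extremal iff
`A_j(x) = ∑_{r=0}^4 a_{jr} x^r` on `I_j` with the three coefficient relations
`a_{24} = −(β₂²/β₁²)a_{14}`, `a_{23} = −4(β₀β₂/β₁²)a_{14} + (β₂/β₁)a_{13}`,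
`a_{22} = −6(β₀²/β₁²)a_{14} + 3(β₀/β₁)a_{13} − a_{12}`. -/
theorem statement5 (β0 β1 β2 : ℝ) (hβ1 : β1 ≠ 0) (hβ2 : β2 ≠ 0)
    (I : Fin 2 → Set ℝ)
    (hI : ∀ j, ∃ u v : ℝ, u < v ∧ I j = Set.Ioo u v)
    (A : Fin 2 → ℝ → ℝ) (hA : ∀ j, ContDiffOn ℝ (⊤ : ℕ∞) (A j) (I j))
    (hP : ∀ x : Fin 2 → ℝ, (∀ j, x j ∈ I j) → PS 2 β0 ![β1, β2] x ≠ 0) :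
    IsExtremalS 2 β0 ![β1, β2] I A ↔
      ∃ c : Fin 2 → Fin 5 → ℝ,
        (∀ j : Fin 2, ∀ x ∈ I j, A j x = ∑ r : Fin 5, c j r * x ^ (r : ℕ)) ∧
        c 1 4 = -(β2 ^ 2 / β1 ^ 2) * c 0 4 ∧
        c 1 3 = -(4 * (β0 * β2) / β1 ^ 2) * c 0 4 + (β2 / β1) * c 0 3 ∧
        c 1 2 = -(6 * (β0 ^ 2) / β1 ^ 2) * c 0 4 + 3 * (β0 / β1) * c 0 3 - c 0 2 := by
  have hO (j) : IsOpen (I j) := by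
    obtain ⟨u, v, -, h⟩ := hI j
    exact h ▸ isOpen_Ioo
  have hC (j) : IsPreconnected (I j) := by
    obtain ⟨u, v, -, h⟩ := hI j
    exact h ▸ isPreconnected_Ioo
  have hN (j) : ∃ x, x ∈ I j := by
    obtain ⟨u, v, huv, h⟩ := hI j
    exact h ▸ Set.nonempty_Ioo.2 huv
  constructor
  · rintro ⟨α0, α, h⟩
    have D (j) := (hA j).hasDerivAt_and_contDiffOn_deriv (hO j)
    have D1 (j) := (D j).2.hasDerivAt_and_contDiffOn_deriv (hO j)
    have D2 (j) := (D1 j).2.hasDerivAt_and_contDiffOn_deriv (hO j)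
    have D3 (j) := (D2 j).2.hasDerivAt_and_contDiffOn_deriv (hO j)
    have key := fourth_deriv_relations (b0 := β0) (b1 := β1) (b2 := β2) (α0 := α0)
      (α1 := α 0) (α2 := α 1) (g := A 1) (hO 0) (hO 1) (D 0).1 (D1 0).1 (D2 0).1 (D3 0).1
      (D1 1).1 (D2 1).1 (D3 1).1 (by
        intro x hx y hy
        have := h ![x, y] (by simp [Fin.forall_fin_two, hx, hy])
        simp [PS, Fin.sum_univ_two] at this
        linear_combination this)
    obtain ⟨x, hx⟩ := hN 0
    obtain ⟨y, hy⟩ := hN 1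
    obtain ⟨c, hc4, hc⟩ := exists_quartic_of_hasDerivAt_const (hO 0) (hC 0) (D 0).1 (D1 0).1
      (D2 0).1 (fun t ht => ((D3 0).1 t ht).congr_deriv (mul_left_cancel₀ (pow_ne_zero 2 hβ2)
        ((key t ht y hy).2.2.trans (key x hx y hy).2.2.symm)))
    obtain ⟨d, hd4, hd⟩ := exists_quartic_of_hasDerivAt_const (hO 1) (hC 1) (D 1).1 (D1 1).1
      (D2 1).1 (fun t ht => ((D3 1).1 t ht).congr_deriv (mul_left_cancel₀
        (neg_ne_zero.2 (pow_ne_zero 2 hβ1))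
        ((key x hx t ht).2.2.symm.trans (key x hx y hy).2.2)))
    obtain ⟨e2, e3, e4⟩ := key x hx y hy
    rw [hc4, hd4] at e4
    rw [hc4, (hc x hx).2.2, (hd y hy).2.2] at e3
    rw [(hc x hx).2.2, (hd y hy).2.2, (hc x hx).2.1, (hd y hy).2.1] at e2
    have r4 : d 4 = -(β2 ^ 2 / β1 ^ 2) * c 4 := by
      field_simp
      linear_combination e4 / 24
    have r3 : d 3 = -(4 * (β0 * β2) / β1 ^ 2) * c 4 + (β2 / β1) * c 3 := by
      rw [r4] at e3
      field_simp at e3 ⊢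
      linear_combination e3 / 6
    have r2 : d 2 = -(6 * (β0 ^ 2) / β1 ^ 2) * c 4 + 3 * (β0 / β1) * c 3 - c 2 := by
      rw [r4, r3] at e2
      field_simp at e2 ⊢
      linear_combination -e2 / 4
    refine ⟨![c, d], Fin.forall_fin_two.2 ⟨fun t ht => ?_, fun t ht => ?_⟩, r4, r3, r2⟩
    · simp [(hc t ht).1, Fin.sum_univ_five]
    · simp [(hd t ht).1, Fin.sum_univ_five]
  · rintro ⟨c, hc, r4, r3, r2⟩
    have e0 (j) (x) (hx : x ∈ I j) :
        A j x = c j 0 + c j 1 * x + c j 2 * x ^ 2 + c j 3 * x ^ 3 + c j 4 * x ^ 4 := by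
      simp [hc j x hx, Fin.sum_univ_five]
    have e1 (j) := deriv_of_eqOn_quartic (hO j) (e0 j)
    have e2 (j) := deriv_of_eqOn_quartic (f := deriv (A j)) (a := c j 1) (b := 2 * c j 2)
      (c := 3 * c j 3) (d := 4 * c j 4) (e := 0) (hO j) (fun x hx => by rw [e1 j x hx]; ring)
    refine ⟨β0 ^ 2 * (2 * c 0 2 + 2 * c 1 2) - 6 * β0 * (β1 * c 0 1 + β2 * c 1 1)
        + 12 * (β1 ^ 2 * c 0 0 + β2 ^ 2 * c 1 0),
      ![6 * β0 ^ 2 * c 0 3 + β0 * β1 * (4 * c 1 2 - 8 * c 0 2)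
          + 6 * β1 * (β1 * c 0 1 - β2 * c 1 1),
        6 * β0 ^ 2 * c 1 3 + β0 * β2 * (4 * c 0 2 - 8 * c 1 2)
          + 6 * β2 * (β2 * c 1 1 - β1 * c 0 1)], fun x hx => ?_⟩
    simp only [PS, Fin.sum_univ_two, e0 _ _ (hx _), e1 _ _ (hx _), e2 _ _ (hx _), r4, r3, r2,
      Matrix.cons_val_zero, Matrix.cons_val_one]
    push_cast
    field_simp
    ring
end
end

section
/- Assume m ≥ 3 and that the set S = { j ∈ {1,…,m} : β_j ≠ 0 } has at least two elements. Then (A₁,…,A_m) is extremal if and only if each A_j with j ∈ S agrees on I_j with a polynomial of degree at most 1, each A_r with r ∉ S agrees on I_r with a polynomial of degree at most 2 (so each such A_r'' is a constant), and ∑_{r∉S} A_r'' = 0. -/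
open scoped Classical

noncomputable section

/-- Two functions that agree on an open set have the same derivative there. -/
theorem deriv_unique_of_eqOn {u v : ℝ → ℝ} {U : Set ℝ} (hU : IsOpen U)
    (huv : ∀ s ∈ U, u s = v s) {s u' v' : ℝ} (hs : s ∈ U)
    (hu : HasDerivAt u u' s) (hv : HasDerivAt v v' s) : u' = v' :=
  (hu.congr_of_eventuallyEq
    (Filter.eventuallyEq_of_mem (hU.mem_nhds hs) fun x hx => (huv x hx).symm)).unique hv

/-- Differential consequences of the extremality equation restricted to two variables `s`, `t`,
where `f n`, `g n` stand for the `n`-th derivatives of the two unknown functions. -/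
theorem two_variable_identities {U V : Set ℝ} (hU : IsOpen U) (hV : IsOpen V)
    {f g : ℕ → ℝ → ℝ}
    (hf : ∀ n, ∀ s ∈ U, HasDerivAt (f n) (f (n + 1) s) s)
    (hg : ∀ n, ∀ t ∈ V, HasDerivAt (g n) (g (n + 1) t) t)
    {N p₀ b c K L M α₀ α₁ α₂ : ℝ}
    (hE : ∀ s ∈ U, ∀ t ∈ V,
      (p₀ + b * s + c * t) ^ 2 * (K + f 2 s + g 2 t)
        - 2 * N * (p₀ + b * s + c * t) * (L + b * f 1 s + c * g 1 t)
        + N * (N + 1) * (M + b ^ 2 * f 0 s + c ^ 2 * g 0 t) = α₀ + α₁ * s + α₂ * t) :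
    ∀ s ∈ U, ∀ t ∈ V,
      (2 * b * c * (K + f 2 s + g 2 t) + 2 * (p₀ + b * s + c * t) * (b * g 3 t + c * f 3 s)
        - 2 * N * b * c * (f 2 s + g 2 t) = 0) ∧
      (2 * b ^ 2 * (K + f 2 s + g 2 t) + (4 - 2 * N) * b * (p₀ + b * s + c * t) * f 3 s
        + (p₀ + b * s + c * t) ^ 2 * f 4 s + N * (N - 3) * b ^ 2 * f 2 s = 0) ∧
      ((4 - 2 * N) * b * c * f 3 s + 2 * b ^ 2 * g 3 t
        + 2 * c * (p₀ + b * s + c * t) * f 4 s = 0) ∧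
      (b ^ 2 * g 4 t + c ^ 2 * f 4 s = 0) ∧
      ((6 - 2 * N) * b * c * f 4 s + 2 * c * (p₀ + b * s + c * t) * f 5 s = 0) ∧
      c ^ 2 * f 5 s = 0 := by
  have hps : ∀ s t, HasDerivAt (fun s => p₀ + b * s + c * t) b s := fun s t => by
    simpa using (((hasDerivAt_id s).const_mul b).const_add p₀).add_const (c * t)
  have hpt : ∀ s t, HasDerivAt (fun t => p₀ + b * s + c * t) c t := fun s t => by
    simpa using ((hasDerivAt_id t).const_mul c).const_add (p₀ + b * s)
  have hE1 : ∀ s ∈ U, ∀ t ∈ V,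
      2 * b * (p₀ + b * s + c * t) * (K + f 2 s + g 2 t) + (p₀ + b * s + c * t) ^ 2 * f 3 s
        - 2 * N * b * (L + b * f 1 s + c * g 1 t) - 2 * N * (p₀ + b * s + c * t) * (b * f 2 s)
        + N * (N + 1) * (b ^ 2 * f 1 s) = α₁ := by
    intro s hs t ht
    refine deriv_unique_of_eqOn hU (fun s hs => hE s hs t ht) hs ?_ ?_
    · have := ((((hps s t).pow 2).mul (((hf 2 s hs).const_add K).add_const (g 2 t))).sub
        (((hps s t).const_mul (2 * N)).mul
          ((((hf 1 s hs).const_mul b).const_add L).add_const (c * g 1 t)))).add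
        (((((hf 0 s hs).const_mul (b ^ 2)).const_add M).add_const
          (c ^ 2 * g 0 t)).const_mul (N * (N + 1)))
      refine this.congr_deriv ?_
      simp
      ring
    · simpa using (((hasDerivAt_id s).const_mul α₁).const_add α₀).add_const (α₂ * t)
  have hE12 : ∀ s ∈ U, ∀ t ∈ V,
      2 * b * c * (K + f 2 s + g 2 t) + 2 * (p₀ + b * s + c * t) * (b * g 3 t + c * f 3 s)
        - 2 * N * b * c * (f 2 s + g 2 t) = 0 := by
    intro s hs t ht
    refine deriv_unique_of_eqOn hV (fun t ht => hE1 s hs t ht) ht ?_ (hasDerivAt_const t α₁)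
    have := ((((((hpt s t).const_mul (2 * b)).mul ((hg 2 t ht).const_add (K + f 2 s))).add
      (((hpt s t).pow 2).mul_const (f 3 s))).sub
      ((((hg 1 t ht).const_mul c).const_add (L + b * f 1 s)).const_mul (2 * N * b))).sub
      (((hpt s t).const_mul (2 * N)).mul_const (b * f 2 s))).add_const
      (N * (N + 1) * (b ^ 2 * f 1 s))
    refine this.congr_deriv ?_
    simp
    ring
  have hE11 : ∀ s ∈ U, ∀ t ∈ V,
      2 * b ^ 2 * (K + f 2 s + g 2 t) + (4 - 2 * N) * b * (p₀ + b * s + c * t) * f 3 s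
        + (p₀ + b * s + c * t) ^ 2 * f 4 s + N * (N - 3) * b ^ 2 * f 2 s = 0 := by
    intro s hs t ht
    refine deriv_unique_of_eqOn hU (fun s hs => hE1 s hs t ht) hs ?_ (hasDerivAt_const s α₁)
    have := ((((((hps s t).const_mul (2 * b)).mul
      (((hf 2 s hs).const_add K).add_const (g 2 t))).add
      (((hps s t).pow 2).mul (hf 3 s hs))).sub
      ((((hf 1 s hs).const_mul b).const_add L).add_const (c * g 1 t) |>.const_mul
        (2 * N * b))).sub
      (((hps s t).const_mul (2 * N)).mul ((hf 2 s hs).const_mul b))).add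
      (((hf 1 s hs).const_mul (b ^ 2)).const_mul (N * (N + 1)))
    refine this.congr_deriv ?_
    simp
    ring
  have hE112 : ∀ s ∈ U, ∀ t ∈ V,
      (4 - 2 * N) * b * c * f 3 s + 2 * b ^ 2 * g 3 t
        + 2 * c * (p₀ + b * s + c * t) * f 4 s = 0 := by
    intro s hs t ht
    refine deriv_unique_of_eqOn hU (fun s hs => hE12 s hs t ht) hs ?_ (hasDerivAt_const s 0)
    have := (((((hf 2 s hs).const_add K).add_const (g 2 t)).const_mul (2 * b * c)).add
      (((hps s t).const_mul 2).mul (((hf 3 s hs).const_mul c).const_add (b * g 3 t)))).sub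
      (((hf 2 s hs).add_const (g 2 t)).const_mul (2 * N * b * c))
    refine this.congr_deriv ?_
    ring
  have hE1122 : ∀ s ∈ U, ∀ t ∈ V, b ^ 2 * g 4 t + c ^ 2 * f 4 s = 0 := by
    intro s hs t ht
    have h : 2 * (b ^ 2 * g 4 t + c ^ 2 * f 4 s) = 0 := by
      refine deriv_unique_of_eqOn hV (fun t ht => hE112 s hs t ht) ht ?_ (hasDerivAt_const t 0)
      have := (((hg 3 t ht).const_mul (2 * b ^ 2)).const_add
        ((4 - 2 * N) * b * c * f 3 s)).add (((hpt s t).const_mul (2 * c)).mul_const (f 4 s))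
      refine this.congr_deriv ?_
      ring
    linarith
  intro s hs t ht
  refine ⟨hE12 s hs t ht, hE11 s hs t ht, hE112 s hs t ht, hE1122 s hs t ht, ?_, ?_⟩
  · refine deriv_unique_of_eqOn hU (fun s hs => hE112 s hs t ht) hs ?_ (hasDerivAt_const s 0)
    have := (((hf 3 s hs).const_mul ((4 - 2 * N) * b * c)).add_const (2 * b ^ 2 * g 3 t)).add
      (((hps s t).const_mul (2 * c)).mul (hf 4 s hs))
    refine this.congr_deriv ?_
    ring
  · exact deriv_unique_of_eqOn hU (fun s hs => hE1122 s hs t ht) hs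
      (((hf 4 s hs).const_mul (c ^ 2)).const_add (b ^ 2 * g 4 t)) (hasDerivAt_const s 0)

/-- If both variables occur in `P`, the second derivatives vanish, and so does the contribution
`K` of the remaining variables. -/
theorem two_variable_second_deriv_eq_zero {U V : Set ℝ} (hU : IsOpen U) (hV : IsOpen V)
    {f g : ℕ → ℝ → ℝ}
    (hf : ∀ n, ∀ s ∈ U, HasDerivAt (f n) (f (n + 1) s) s)
    (hg : ∀ n, ∀ t ∈ V, HasDerivAt (g n) (g (n + 1) t) t)
    {N p₀ b c K L M α₀ α₁ α₂ : ℝ} (hN : 4 ≤ N) (hb : b ≠ 0) (hc : c ≠ 0)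
    (hE : ∀ s ∈ U, ∀ t ∈ V,
      (p₀ + b * s + c * t) ^ 2 * (K + f 2 s + g 2 t)
        - 2 * N * (p₀ + b * s + c * t) * (L + b * f 1 s + c * g 1 t)
        + N * (N + 1) * (M + b ^ 2 * f 0 s + c ^ 2 * g 0 t) = α₀ + α₁ * s + α₂ * t) :
    ∀ s ∈ U, ∀ t ∈ V, f 2 s = 0 ∧ g 2 t = 0 ∧ K = 0 := by
  intro s hs t ht
  obtain ⟨h12, h11, h112, h1122, h1112, h11122⟩ :=
    two_variable_identities hU hV hf hg hE s hs t ht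
  obtain ⟨-, h22, h221, -, -, -⟩ :=
    two_variable_identities (b := c) (c := b) (p₀ := p₀) (N := N) (K := K) (L := L) (M := M)
      (α₀ := α₀) (α₁ := α₂) (α₂ := α₁) hV hU hg hf
      (fun t ht s hs => by linear_combination hE s hs t ht) t ht s hs
  have hf5 : f 5 s = 0 := by simpa [hc] using h11122
  have hf4 : f 4 s = 0 := by
    have h : (6 - 2 * N) * b * c ≠ 0 :=
      mul_ne_zero (mul_ne_zero (by linarith) hb) hc
    rw [hf5] at h1112
    simpa [h] using h1112
  have hg4 : g 4 t = 0 := by simpa [hf4, hb] using h1122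
  rw [hf4] at h112 h11
  rw [hg4] at h221 h22
  have hbg : b * g 3 t = (N - 2) * (c * f 3 s) := by
    refine mul_left_cancel₀ hb ?_
    linear_combination h112 / 2
  have hcf : c * f 3 s = (N - 2) * (b * g 3 t) := by
    refine mul_left_cancel₀ hc ?_
    linear_combination h221 / 2
  have hcf0 : c * f 3 s = 0 := by
    have h : (N - 1) * (N - 3) ≠ 0 := mul_ne_zero (by linarith) (by linarith)
    refine (mul_eq_zero.mp ?_).resolve_left h
    linear_combination (-1) * hcf - (N - 2) * hbg
  have hf3 : f 3 s = 0 := by simpa [hc] using hcf0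
  have hg3 : g 3 t = 0 := by simpa [hf3, hb] using hbg
  rw [hf3] at h11 h12
  rw [hg3] at h22 h12
  have e12 : K + f 2 s + g 2 t = N * (f 2 s + g 2 t) := by
    refine mul_left_cancel₀ (mul_ne_zero hb hc) ?_
    linear_combination h12 / 2
  have e11 : 2 * (K + f 2 s + g 2 t) = - (N * (N - 3)) * f 2 s := by
    refine mul_left_cancel₀ (pow_ne_zero 2 hb) ?_
    linear_combination h11
  have e22 : 2 * (K + f 2 s + g 2 t) = - (N * (N - 3)) * g 2 t := by
    refine mul_left_cancel₀ (pow_ne_zero 2 hc) ?_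
    linear_combination h22
  have hfg : f 2 s = g 2 t := by
    refine mul_left_cancel₀ (mul_ne_zero (a := N) (b := N - 3) (by linarith) (by linarith)) ?_
    linear_combination e11 - e22
  have hf2 : f 2 s = 0 := by
    refine (mul_eq_zero.mp ?_).resolve_left
      (mul_ne_zero (a := N) (b := N + 1) (by linarith) (by linarith))
    linear_combination e11 - 2 * e12 + 2 * N * hfg
  have hg2 : g 2 t = 0 := hfg ▸ hf2
  exact ⟨hf2, hg2, by simpa [hf2, hg2] using e12⟩

/-- If only the first variable occurs in `P`, the function of the second variable has vanishing
third derivative. -/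
theorem two_variable_third_deriv_eq_zero {U V : Set ℝ} (hU : IsOpen U) (hV : IsOpen V)
    {f g : ℕ → ℝ → ℝ}
    (hf : ∀ n, ∀ s ∈ U, HasDerivAt (f n) (f (n + 1) s) s)
    (hg : ∀ n, ∀ t ∈ V, HasDerivAt (g n) (g (n + 1) t) t)
    {N p₀ b c K L M α₀ α₁ α₂ : ℝ} (hb : b ≠ 0) (hc : c = 0)
    (hE : ∀ s ∈ U, ∀ t ∈ V,
      (p₀ + b * s + c * t) ^ 2 * (K + f 2 s + g 2 t)
        - 2 * N * (p₀ + b * s + c * t) * (L + b * f 1 s + c * g 1 t)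
        + N * (N + 1) * (M + b ^ 2 * f 0 s + c ^ 2 * g 0 t) = α₀ + α₁ * s + α₂ * t) :
    ∀ s ∈ U, ∀ t ∈ V, g 3 t = 0 := by
  intro s hs t ht
  have h := (two_variable_identities hU hV hf hg hE s hs t ht).2.2.1
  simpa [hc, hb] using h

/-- A function on an open interval with vanishing derivative is constant. -/
theorem eq_of_hasDerivAt_zero {u v : ℝ} {f : ℝ → ℝ}
    (hf : ∀ x ∈ Set.Ioo u v, HasDerivAt f 0 x) {x y : ℝ}
    (hx : x ∈ Set.Ioo u v) (hy : y ∈ Set.Ioo u v) : f x = f y :=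
  isOpen_Ioo.is_const_of_deriv_eq_zero isPreconnected_Ioo
    (fun x hx => (hf x hx).differentiableAt.differentiableWithinAt)
    (fun x hx => (hf x hx).deriv) hx hy

/-- A function whose second derivative is constant on an open interval is a quadratic
polynomial there. -/
theorem eq_quadratic_of_second_deriv_const {u v a d : ℝ} {f f₁ : ℝ → ℝ}
    (ha : a ∈ Set.Ioo u v)
    (hf : ∀ x ∈ Set.Ioo u v, HasDerivAt f (f₁ x) x)
    (hf₁ : ∀ x ∈ Set.Ioo u v, HasDerivAt f₁ (2 * d) x) :
    ∃ c₀ c₁ : ℝ, ∀ x ∈ Set.Ioo u v, f x = c₀ + c₁ * x + d * x ^ 2 := by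
  have h1 : ∀ x ∈ Set.Ioo u v, f₁ x - 2 * d * x = f₁ a - 2 * d * a := fun x hx =>
    eq_of_hasDerivAt_zero (f := fun x => f₁ x - 2 * d * x)
      (fun x hx => ((hf₁ x hx).sub ((hasDerivAt_id x).const_mul (2 * d))).congr_deriv (by simp))
      hx ha
  set c₁ := f₁ a - 2 * d * a
  have h0 : ∀ x ∈ Set.Ioo u v,
      f x - (c₁ * x + d * x ^ 2) = f a - (c₁ * a + d * a ^ 2) := fun x hx => by
    refine eq_of_hasDerivAt_zero (f := fun x => f x - (c₁ * x + d * x ^ 2))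
      (fun x hx => ?_) hx ha
    refine ((hf x hx).sub (((hasDerivAt_id x).const_mul c₁).add
      (((hasDerivAt_id x).pow 2).const_mul d))).congr_deriv ?_
    have := h1 x hx
    simp
    linear_combination this
  exact ⟨f a - (c₁ * a + d * a ^ 2), c₁, fun x hx => by linear_combination h0 x hx⟩

/-- Iterated derivatives of a smooth function on an open set are derivatives of each other. -/
theorem hasDerivAt_iterate_deriv_s6 {U : Set ℝ} (hU : IsOpen U) {f : ℝ → ℝ}
    (hf : ContDiffOn ℝ (⊤ : ℕ∞) f U) (n : ℕ) :
    ∀ x ∈ U, HasDerivAt (deriv^[n] f) (deriv^[n + 1] f x) x := by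
  have h : ContDiffOn ℝ (⊤ : ℕ∞) (deriv^[n] f) U := by
    induction n with
    | zero => exact hf
    | succ k ih =>
      rw [Function.iterate_succ_apply']
      exact ((contDiffOn_infty_iff_deriv_of_isOpen hU).1 ih).2
  intro x hx
  rw [Function.iterate_succ_apply']
  exact ((h.contDiffAt (hU.mem_nhds hx)).differentiableAt (by simp)).hasDerivAt

/-- Splitting off the two updated coordinates from a sum. -/
theorem sum_update_update {m : ℕ} {i k : Fin m} (hik : i ≠ k) (a : Fin m → ℝ)
    (h : Fin m → ℝ → ℝ) (s t : ℝ) :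
    ∑ j, h j (Function.update (Function.update a i s) k t j)
      = (∑ j ∈ (Finset.univ.erase k).erase i, h j (a j)) + h i s + h k t := by
  rw [← Finset.sum_erase_add _ _ (Finset.mem_univ k),
    ← Finset.sum_erase_add (Finset.univ.erase k) _ (Finset.mem_erase.2 ⟨hik, Finset.mem_univ i⟩)]
  congr 1
  · congr 1
    · refine Finset.sum_congr rfl fun j hj => ?_
      simp only [Finset.mem_erase] at hj
      rw [Function.update_of_ne hj.2.1, Function.update_of_ne hj.1]
    · rw [Function.update_of_ne hik, Function.update_self]
  · rw [Function.update_self]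

/-- The extremality equation restricted to a coordinate plane through a point. -/
theorem extremal_equation_two_variable {m : ℕ} {β0 : ℝ} {β : Fin m → ℝ} {I : Fin m → Set ℝ}
    {A : Fin m → ℝ → ℝ} {α0 : ℝ} {α : Fin m → ℝ}
    (hE : ∀ x : Fin m → ℝ, (∀ j, x j ∈ I j) →
      (∑ j : Fin m,
        ((PS m β0 β x) ^ 2 * deriv (deriv (A j)) (x j)
          - 2 * ((m : ℝ) + 1) * β j * PS m β0 β x * deriv (A j) (x j)
          + ((m : ℝ) + 1) * ((m : ℝ) + 2) * β j ^ 2 * A j (x j)))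
      = α0 + ∑ j : Fin m, α j * x j)
    {a : Fin m → ℝ} (ha : ∀ j, a j ∈ I j) {i k : Fin m} (hik : i ≠ k) :
    ∃ p₀ L M α₀ : ℝ, ∀ s ∈ I i, ∀ t ∈ I k,
      (p₀ + β i * s + β k * t) ^ 2 *
          ((∑ j ∈ (Finset.univ.erase k).erase i, deriv^[2] (A j) (a j))
            + deriv^[2] (A i) s + deriv^[2] (A k) t)
        - 2 * ((m : ℝ) + 1) * (p₀ + β i * s + β k * t) *
          (L + β i * deriv^[1] (A i) s + β k * deriv^[1] (A k) t)
        + ((m : ℝ) + 1) * ((m : ℝ) + 1 + 1) *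
          (M + β i ^ 2 * deriv^[0] (A i) s + β k ^ 2 * deriv^[0] (A k) t)
        = α₀ + α i * s + α k * t := by
  set R := (Finset.univ.erase k).erase i
  refine ⟨β0 + ∑ j ∈ R, β j * a j, ∑ j ∈ R, β j * deriv (A j) (a j),
    ∑ j ∈ R, β j ^ 2 * A j (a j), α0 + ∑ j ∈ R, α j * a j, fun s hs t ht => ?_⟩
  have hx : ∀ j, Function.update (Function.update a i s) k t j ∈ I j := by
    intro j
    rcases eq_or_ne j k with rfl | hjk
    · simpa using ht
    rcases eq_or_ne j i with rfl | hji
    · simpa [hjk] using hs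
    · simpa [hjk, hji] using ha j
  have h := hE _ hx
  have hPS : PS m β0 β (Function.update (Function.update a i s) k t)
      = β0 + ∑ j ∈ R, β j * a j + β i * s + β k * t := by
    rw [PS, sum_update_update hik a (fun j y => β j * y) s t]
    ring
  rw [hPS] at h
  set p := β0 + ∑ j ∈ R, β j * a j + β i * s + β k * t
  rw [sum_update_update hik a (fun j y => p ^ 2 * deriv (deriv (A j)) y
      - 2 * ((m : ℝ) + 1) * β j * p * deriv (A j) y
      + ((m : ℝ) + 1) * ((m : ℝ) + 2) * β j ^ 2 * A j y) s t,
    sum_update_update hik a (fun j y => α j * y) s t,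
    Finset.sum_add_distrib, Finset.sum_sub_distrib, ← Finset.mul_sum] at h
  have h1 : ∑ j ∈ R, 2 * ((m : ℝ) + 1) * β j * p * deriv (A j) (a j)
      = 2 * ((m : ℝ) + 1) * p * ∑ j ∈ R, β j * deriv (A j) (a j) := by
    rw [Finset.mul_sum]
    exact Finset.sum_congr rfl fun j _ => by ring
  have h2 : ∑ j ∈ R, ((m : ℝ) + 1) * ((m : ℝ) + 2) * β j ^ 2 * A j (a j)
      = ((m : ℝ) + 1) * ((m : ℝ) + 2) * ∑ j ∈ R, β j ^ 2 * A j (a j) := by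
    rw [Finset.mul_sum]
    exact Finset.sum_congr rfl fun j _ => by ring
  rw [h1, h2] at h
  simp only [Function.iterate_succ, Function.iterate_zero, Function.comp_apply, id_eq]
  linear_combination h

/-- Quadratic polynomials satisfying the linear constraints solve the extremality equation. -/
theorem isExtremalS_of_quadratic {m : ℕ} {β0 : ℝ} {β : Fin m → ℝ} {I : Fin m → Set ℝ}
    (hI : ∀ j, IsOpen (I j)) {A : Fin m → ℝ → ℝ} {c0 c1 c2 : Fin m → ℝ}
    (hA : ∀ j, ∀ x ∈ I j, A j x = c0 j + c1 j * x + c2 j * x ^ 2)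
    (hc2 : ∀ j, β j * c2 j = 0) (hsum : ∑ j, 2 * c2 j = 0) :
    IsExtremalS m β0 β I A := by
  have hd : ∀ j, ∀ x ∈ I j, deriv (A j) x = c1 j + 2 * c2 j * x := by
    intro j x hx
    rw [(Filter.eventuallyEq_of_mem ((hI j).mem_nhds hx) (hA j)).deriv_eq]
    refine (((((hasDerivAt_id x).const_mul (c1 j)).const_add (c0 j)).add
      (((hasDerivAt_id x).pow 2).const_mul (c2 j))).congr_deriv ?_).deriv
    simp
    ring
  have hdd : ∀ j, ∀ x ∈ I j, deriv (deriv (A j)) x = 2 * c2 j := by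
    intro j x hx
    rw [(Filter.eventuallyEq_of_mem ((hI j).mem_nhds hx) (hd j)).deriv_eq]
    refine ((((hasDerivAt_id x).const_mul (2 * c2 j)).const_add (c1 j)).congr_deriv ?_).deriv
    simp
  set κ := ∑ j, β j * c1 j with hκ
  refine ⟨-2 * ((m : ℝ) + 1) * β0 * κ + ∑ j, ((m : ℝ) + 1) * ((m : ℝ) + 2) * β j ^ 2 * c0 j,
    fun j => -2 * ((m : ℝ) + 1) * κ * β j + ((m : ℝ) + 1) * ((m : ℝ) + 2) * β j ^ 2 * c1 j,
    fun x hx => ?_⟩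
  have hp : PS m β0 β x = β0 + ∑ j, β j * x j := rfl
  set p := PS m β0 β x
  have h1 : ∑ j : Fin m, (p ^ 2 * deriv (deriv (A j)) (x j)
        - 2 * ((m : ℝ) + 1) * β j * p * deriv (A j) (x j)
        + ((m : ℝ) + 1) * ((m : ℝ) + 2) * β j ^ 2 * A j (x j))
      = ∑ j : Fin m, (p ^ 2 * (2 * c2 j) - 2 * ((m : ℝ) + 1) * p * (β j * c1 j)
        + ((m : ℝ) + 1) * ((m : ℝ) + 2) * β j ^ 2 * c0 j
        + ((m : ℝ) + 1) * ((m : ℝ) + 2) * β j ^ 2 * c1 j * x j) := by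
    refine Finset.sum_congr rfl fun j _ => ?_
    rw [hdd j _ (hx j), hd j _ (hx j), hA j _ (hx j)]
    linear_combination (-4 * ((m : ℝ) + 1) * p * x j
      + ((m : ℝ) + 1) * ((m : ℝ) + 2) * β j * x j ^ 2) * hc2 j
  have h2 : ∑ j : Fin m, (-2 * ((m : ℝ) + 1) * κ * β j
        + ((m : ℝ) + 1) * ((m : ℝ) + 2) * β j ^ 2 * c1 j) * x j
      = -2 * ((m : ℝ) + 1) * κ * (∑ j, β j * x j)
        + ∑ j : Fin m, ((m : ℝ) + 1) * ((m : ℝ) + 2) * β j ^ 2 * c1 j * x j := by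
    rw [Finset.mul_sum (f := fun j => β j * x j), ← Finset.sum_add_distrib]
    exact Finset.sum_congr rfl fun j _ => by ring
  rw [h1, h2, Finset.sum_add_distrib, Finset.sum_add_distrib, Finset.sum_sub_distrib,
    ← Finset.mul_sum (f := fun j => 2 * c2 j), ← Finset.mul_sum (f := fun j => β j * c1 j),
    hsum, ← hκ]
  linear_combination (-2 * ((m : ℝ) + 1) * κ) * hp

/-- `m ≥ 3` and `S = {j : β_j ≠ 0}` has at least two elements. Then
`(A₁,…,A_m)` is extremal iff each `A_j` with `j ∈ S` agrees on `I_j` with a polynomial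
of degree at most `1`, each `A_r` with `r ∉ S` agrees on `I_r` with a polynomial of
degree at most `2` (with constant second derivative `2·c2 r`), and `∑_{r∉S} A_r'' = 0`. -/
theorem statement6 (m : ℕ) (hm : 3 ≤ m)
    (β0 : ℝ) (β : Fin m → ℝ)
    (hS : 2 ≤ (Finset.univ.filter (fun j => β j ≠ 0)).card)
    (I : Fin m → Set ℝ)
    (hI : ∀ j, ∃ u v : ℝ, u < v ∧ I j = Set.Ioo u v)
    (A : Fin m → ℝ → ℝ) (hA : ∀ j, ContDiffOn ℝ (⊤ : ℕ∞) (A j) (I j))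
    (hP : ∀ x : Fin m → ℝ, (∀ j, x j ∈ I j) → PS m β0 β x ≠ 0) :
    IsExtremalS m β0 β I A ↔
      ∃ c0 c1 c2 : Fin m → ℝ,
        (∀ j : Fin m, ∀ x ∈ I j, A j x = c0 j + c1 j * x + c2 j * x ^ 2) ∧
        (∀ j : Fin m, β j ≠ 0 → c2 j = 0) ∧
        (∑ j ∈ Finset.univ.filter (fun j => β j = 0), 2 * c2 j = 0) := by
  have hIo : ∀ j, IsOpen (I j) := fun j => by
    obtain ⟨u, v, -, h⟩ := hI j
    exact h ▸ isOpen_Ioo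
  have hsplit : ∀ d : Fin m → ℝ, (∀ j, β j ≠ 0 → d j = 0) →
      ∑ j ∈ Finset.univ.filter (fun j => β j = 0), d j = ∑ j, d j := fun d hd =>
    Finset.sum_filter_of_ne fun j _ hj => by_contra fun h => hj (hd j h)
  constructor
  · rintro ⟨α0, α, hE⟩
    have hne : ∀ j, ∃ y, y ∈ I j := fun j => by
      obtain ⟨u, v, huv, h⟩ := hI j
      exact h ▸ Set.nonempty_Ioo.2 huv
    choose a ha using hne
    have hD : ∀ j n, ∀ x ∈ I j, HasDerivAt (deriv^[n] (A j)) (deriv^[n + 1] (A j) x) x :=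
      fun j n => hasDerivAt_iterate_deriv_s6 (hIo j) (hA j) n
    have hN : (4 : ℝ) ≤ (m : ℝ) + 1 := by
      have : (3 : ℝ) ≤ m := by exact_mod_cast hm
      linarith
    have hpair : ∀ i k, i ≠ k → β i ≠ 0 → β k ≠ 0 → ∀ s ∈ I i, deriv^[2] (A i) s = 0 ∧
        deriv^[2] (A k) (a k) = 0 ∧
        ∑ j ∈ (Finset.univ.erase k).erase i, deriv^[2] (A j) (a j) = 0 := by
      intro i k hik hi hk s hs
      obtain ⟨p₀, L, M, α₀, h⟩ := extremal_equation_two_variable hE ha hik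
      exact two_variable_second_deriv_eq_zero (f := fun n => deriv^[n] (A i))
        (g := fun n => deriv^[n] (A k)) (hIo i) (hIo k) (hD i) (hD k) hN hi hk h s hs _ (ha k)
    obtain ⟨i₀, hi₀, k₀, hk₀, hik₀⟩ := Finset.one_lt_card.1 hS
    simp only [Finset.mem_filter, Finset.mem_univ, true_and] at hi₀ hk₀
    have hS2 : ∀ j, β j ≠ 0 → ∀ x ∈ I j, deriv^[2] (A j) x = 0 := by
      intro j hj x hx
      rcases eq_or_ne j i₀ with rfl | hji
      · exact (hpair j k₀ hik₀ hj hk₀ x hx).1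
      · exact (hpair j i₀ hji hj hi₀ x hx).1
    have hconst : ∀ j, ∀ x ∈ I j, deriv^[2] (A j) x = deriv^[2] (A j) (a j) := by
      intro j x hx
      by_cases hj : β j = 0
      · have hij : i₀ ≠ j := fun h => hi₀ (h ▸ hj)
        obtain ⟨p₀, L, M, α₀, h⟩ := extremal_equation_two_variable hE ha hij
        have h3 : ∀ t ∈ I j, deriv^[3] (A j) t = 0 := fun t ht =>
          two_variable_third_deriv_eq_zero (f := fun n => deriv^[n] (A i₀))
            (g := fun n => deriv^[n] (A j)) (hIo i₀) (hIo j) (hD i₀) (hD j) hi₀ hj h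
            _ (ha i₀) t ht
        have haj := ha j
        obtain ⟨u, v, -, hIj⟩ := hI j
        have h2 : ∀ t ∈ I j, HasDerivAt (deriv^[2] (A j)) 0 t := fun t ht =>
          (hD j 2 t ht).congr_deriv (h3 t ht)
        rw [hIj] at h2 hx haj
        exact eq_of_hasDerivAt_zero h2 hx haj
      · rw [hS2 j hj x hx, hS2 j hj _ (ha j)]
    have hquad : ∀ j, ∃ c₀ c₁ : ℝ, ∀ x ∈ I j,
        A j x = c₀ + c₁ * x + deriv^[2] (A j) (a j) / 2 * x ^ 2 := by
      intro j
      have h0 := hD j 0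
      have h1 : ∀ x ∈ I j, HasDerivAt (deriv^[1] (A j)) (2 * (deriv^[2] (A j) (a j) / 2)) x :=
        fun x hx => (hD j 1 x hx).congr_deriv (by rw [hconst j x hx]; ring)
      have haj := ha j
      obtain ⟨u, v, -, hIj⟩ := hI j
      rw [hIj] at h0 h1 haj ⊢
      exact eq_quadratic_of_second_deriv_const haj h0 h1
    choose c0 c1 hc using hquad
    refine ⟨c0, c1, fun j => deriv^[2] (A j) (a j) / 2, hc,
      fun j hj => by simp only [hS2 j hj _ (ha j), zero_div], ?_⟩
    rw [hsplit _ fun j hj => by simp only [hS2 j hj _ (ha j), zero_div, mul_zero],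
      ← Finset.sum_erase_add _ _ (Finset.mem_univ k₀),
      ← Finset.sum_erase_add (Finset.univ.erase k₀) _
        (Finset.mem_erase.2 ⟨hik₀, Finset.mem_univ i₀⟩)]
    simp only [mul_div_cancel₀ _ (two_ne_zero' ℝ), hS2 i₀ hi₀ _ (ha i₀), hS2 k₀ hk₀ _ (ha k₀),
      add_zero]
    exact (hpair i₀ k₀ hik₀ hi₀ hk₀ _ (ha i₀)).2.2
  · rintro ⟨c0, c1, c2, hquad, hc2, hsum⟩
    refine isExtremalS_of_quadratic hIo hquad (fun j => ?_) ?_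
    · by_cases hj : β j = 0
      · rw [hj, zero_mul]
      · rw [hc2 j hj, mul_zero]
    · rw [← hsplit _ fun j hj => by rw [hc2 j hj, mul_zero]]
      exact hsum

end
end

section
/- If the family (A_{ir}) is extremal, then every A_{pq} agrees on its interval I_{pq} with a real polynomial of degree at most m + 2. (This is the statement that every solution of the extremality equation consists of rational functions with denominators prescribed by the factorization structure, specialized to the product Segre–Veronese factorization structure, for which the denominators are trivial.) -/
noncomputable section

/-- `f_i(x) = ∑_{r=1}^{d_i} β_{ir} σ_r(x_{i·})`. -/
def fSV (k : ℕ) (d : Fin k → ℕ) (β : (i : Fin k) → Fin (d i) → ℝ)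
    (x : (i : Fin k) → Fin (d i) → ℝ) (i : Fin k) : ℝ :=
  ∑ r : Fin (d i), β i r * esymm (x i) ((r : ℕ) + 1)

/-- `P(x) = β₀ + ∑_i ∑_{r=1}^{d_i} β_{ir} σ_r(x_{i·})`. -/
def PSV (k : ℕ) (d : Fin k → ℕ) (β0 : ℝ) (β : (i : Fin k) → Fin (d i) → ℝ)
    (x : (i : Fin k) → Fin (d i) → ℝ) : ℝ :=
  β0 + ∑ i : Fin k, fSV k d β x i

/-- `∂P/∂x_{iq} = ∑_{r=1}^{d_i} β_{ir} σ_{r−1}(x̂_{iq})`. -/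
def dPSV (k : ℕ) (d : Fin k → ℕ) (β : (i : Fin k) → Fin (d i) → ℝ)
    (x : (i : Fin k) → Fin (d i) → ℝ) (i : Fin k) (q : Fin (d i)) : ℝ :=
  ∑ r : Fin (d i), β i r * esymmHat (x i) q (r : ℕ)

/-- The extremality equation of the separable Kähler geometry associated with the
product Segre–Veronese factorization structure: there are reals `α₀` and `α_{ir}` such
that for all `x ∈ Ω`,
`∑_i ∑_q [P² A_{iq}'' − 2(m+1) P (∂P/∂x_{iq}) A_{iq}' + (m+1)(m+2) (∂P/∂x_{iq})² A_{iq}] / Δ_{iq}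
  = α₀ + ∑_i ∑_r α_{ir} σ_r(x_{i·})`. -/
def IsExtremalSV (k : ℕ) (d : Fin k → ℕ) (m : ℕ) (β0 : ℝ)
    (β : (i : Fin k) → Fin (d i) → ℝ)
    (I : (i : Fin k) → Fin (d i) → Set ℝ)
    (A : (i : Fin k) → Fin (d i) → ℝ → ℝ) : Prop :=
  ∃ (α0 : ℝ) (α : (i : Fin k) → Fin (d i) → ℝ),
    ∀ x : (i : Fin k) → Fin (d i) → ℝ, (∀ i r, x i r ∈ I i r) →
      (∑ i : Fin k, ∑ q : Fin (d i),
        ((PSV k d β0 β x) ^ 2 * deriv (deriv (A i q)) (x i q)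
          - 2 * ((m : ℝ) + 1) * PSV k d β0 β x * dPSV k d β x i q * deriv (A i q) (x i q)
          + ((m : ℝ) + 1) * ((m : ℝ) + 2) * (dPSV k d β x i q) ^ 2 * A i q (x i q))
          / Delta (x i) q)
      = α0 + ∑ i : Fin k, ∑ r : Fin (d i), α i r * esymm (x i) ((r : ℕ) + 1)

/-- `f` agrees on `S` with a real polynomial of degree at most `n`. -/
def IsPolyOn (S : Set ℝ) (n : ℕ) (f : ℝ → ℝ) : Prop :=
  ∃ R : Polynomial ℝ, R.natDegree ≤ n ∧ ∀ t ∈ S, f t = R.eval t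

namespace IsPolyOn

variable {S : Set ℝ} {n l : ℕ} {f g : ℝ → ℝ}

lemma congr (hf : IsPolyOn S n f) (h : ∀ t ∈ S, g t = f t) : IsPolyOn S n g := by
  obtain ⟨R, hR, hfR⟩ := hf
  exact ⟨R, hR, fun t ht => (h t ht).trans (hfR t ht)⟩

lemma mono (hf : IsPolyOn S n f) (h : n ≤ l) : IsPolyOn S l f := by
  obtain ⟨R, hR, hfR⟩ := hf
  exact ⟨R, hR.trans h, hfR⟩

lemma const (c : ℝ) : IsPolyOn S n fun _ => c :=
  ⟨Polynomial.C c, by simp, by simp⟩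

lemma id : IsPolyOn S 1 fun t => t :=
  ⟨Polynomial.X, by simp, by simp⟩

lemma add (hf : IsPolyOn S n f) (hg : IsPolyOn S n g) : IsPolyOn S n fun t => f t + g t := by
  obtain ⟨R, hR, hfR⟩ := hf
  obtain ⟨Q, hQ, hgQ⟩ := hg
  exact ⟨R + Q, Polynomial.natDegree_add_le_of_degree_le hR hQ,
    fun t ht => by simp [hfR t ht, hgQ t ht]⟩

lemma mul (hf : IsPolyOn S n f) (hg : IsPolyOn S l g) :
    IsPolyOn S (n + l) fun t => f t * g t := by
  obtain ⟨R, hR, hfR⟩ := hf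
  obtain ⟨Q, hQ, hgQ⟩ := hg
  exact ⟨R * Q, Polynomial.natDegree_mul_le_of_le hR hQ,
    fun t ht => by simp [hfR t ht, hgQ t ht]⟩

lemma const_mul (c : ℝ) (hf : IsPolyOn S n f) : IsPolyOn S n fun t => c * f t := by
  simpa using (const (n := 0) c).mul hf

lemma sub (hf : IsPolyOn S n f) (hg : IsPolyOn S n g) : IsPolyOn S n fun t => f t - g t :=
  (hf.add (hg.const_mul (-1))).congr fun t _ => by ring

lemma sum {ι : Type*} (s : Finset ι) {F : ι → ℝ → ℝ} (h : ∀ i ∈ s, IsPolyOn S n (F i)) :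
    IsPolyOn S n fun t => ∑ i ∈ s, F i t := by
  classical
  induction s using Finset.induction_on with
  | empty => simpa using const (S := S) (n := n) 0
  | insert i s hi ih =>
    simp only [Finset.sum_insert hi]
    exact (h i (by simp)).add (ih fun j hj => h j (by simp [hj]))

lemma prod {ι : Type*} (s : Finset ι) {F : ι → ℝ → ℝ} (h : ∀ i ∈ s, IsPolyOn S 1 (F i)) :
    IsPolyOn S s.card fun t => ∏ i ∈ s, F i t := by
  classical
  induction s using Finset.induction_on with
  | empty => simpa using const (S := S) (n := 0) 1
  | insert i s hi ih =>
    simp only [Finset.prod_insert hi, Finset.card_insert_of_notMem hi]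
    exact ((h i (by simp)).mul (ih fun j hj => h j (by simp [hj]))).mono (by omega)

end IsPolyOn

lemma Polynomial.exists_derivative_eq (Q : Polynomial ℝ) :
    ∃ T : Polynomial ℝ, T.derivative = Q := by
  induction Q using Polynomial.induction_on' with
  | add p q hp hq =>
    obtain ⟨T, rfl⟩ := hp
    obtain ⟨U, rfl⟩ := hq
    exact ⟨T + U, Polynomial.derivative_add⟩
  | monomial n a =>
    refine ⟨Polynomial.monomial (n + 1) (a / (n + 1)), ?_⟩
    rw [Polynomial.derivative_monomial]
    have : (n : ℝ) + 1 ≠ 0 := by positivity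
    simp [div_mul_cancel₀ _ this]

lemma IsPolyOn.of_deriv {u v : ℝ} {n : ℕ} {f : ℝ → ℝ}
    (hf : DifferentiableOn ℝ f (Set.Ioo u v)) (h : IsPolyOn (Set.Ioo u v) n (deriv f)) :
    IsPolyOn (Set.Ioo u v) (n + 1) f := by
  obtain ⟨Q, hQ, hfQ⟩ := h
  obtain ⟨T, rfl⟩ := Q.exists_derivative_eq
  have hT : T.natDegree ≤ n + 1 := by
    have := Polynomial.natDegree_derivative T
    omega
  rcases (Set.Ioo u v).eq_empty_or_nonempty with he | ⟨c, hc⟩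
  · exact ⟨0, by simp, by simp [he]⟩
  refine ⟨T + Polynomial.C (f c - T.eval c), by rwa [Polynomial.natDegree_add_C], fun t ht => ?_⟩
  have hd : Set.EqOn (deriv fun t => f t - T.eval t) 0 (Set.Ioo u v) := by
    intro t ht
    have h1 := (hf.differentiableAt (isOpen_Ioo.mem_nhds ht)).hasDerivAt.sub (T.hasDerivAt t)
    exact h1.deriv.trans (by simp [hfQ t ht])
  have hconst := isOpen_Ioo.is_const_of_deriv_eq_zero isPreconnected_Ioo
    (hf.sub T.differentiable.differentiableOn) hd ht hc
  simp only [Pi.sub_apply] at hconst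
  simp only [Polynomial.eval_add, Polynomial.eval_C]
  linarith

/-- Smooth solutions of the Euler-type equation
`y² A'' - 2 n y y' A' + n (n + 1) y'² A = R` with `y = a + b t` affine and `deg R < n` are
polynomials of degree at most `n + 1`. -/
lemma isPolyOn_of_euler_ode {u v a b : ℝ} (hne : ∀ t ∈ Set.Ioo u v, a + b * t ≠ 0) (n : ℕ) :
    ∀ (A : ℝ → ℝ) (R : Polynomial ℝ), ContDiffOn ℝ (⊤ : ℕ∞) A (Set.Ioo u v) → R.degree < n →
      (∀ t ∈ Set.Ioo u v, (a + b * t) ^ 2 * deriv (deriv A) t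
        - 2 * n * (a + b * t) * b * deriv A t + n * (n + 1) * b ^ 2 * A t = R.eval t) →
      IsPolyOn (Set.Ioo u v) (n + 1) A := by
  have hsmooth : ∀ A : ℝ → ℝ, ContDiffOn ℝ (⊤ : ℕ∞) A (Set.Ioo u v) →
      ContDiffOn ℝ (⊤ : ℕ∞) (deriv A) (Set.Ioo u v) := fun A hA =>
    hA.deriv_of_isOpen isOpen_Ioo (by simp)
  have hdiff : ∀ A : ℝ → ℝ, ContDiffOn ℝ (⊤ : ℕ∞) A (Set.Ioo u v) →
      DifferentiableOn ℝ A (Set.Ioo u v) := fun A hA => hA.differentiableOn (by simp)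
  induction n with
  | zero =>
    intro A R hA hR h
    obtain rfl : R = 0 := by
      rw [← Polynomial.degree_eq_bot]
      by_contra h0
      rw [Polynomial.degree_eq_bot] at h0
      rw [Polynomial.degree_eq_natDegree h0] at hR
      exact absurd (Nat.cast_lt.mp hR) (Nat.not_lt_zero _)
    have h2 : ∀ t ∈ Set.Ioo u v, deriv (deriv A) t = 0 := by
      intro t ht
      have := h t ht
      simpa [hne t ht] using this
    have hconst : IsPolyOn (Set.Ioo u v) 0 (deriv A) := by
      rcases (Set.Ioo u v).eq_empty_or_nonempty with he | ⟨c, hc⟩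
      · exact ⟨0, by simp, by simp [he]⟩
      · exact (IsPolyOn.const (deriv A c)).congr fun t ht =>
          isOpen_Ioo.is_const_of_deriv_eq_zero isPreconnected_Ioo (hdiff _ (hsmooth A hA))
            (fun t ht => h2 t ht) ht hc
    exact IsPolyOn.of_deriv (hdiff A hA) hconst
  | succ n ih =>
    intro A R hA hR h
    refine IsPolyOn.of_deriv (hdiff A hA) (ih (deriv A) R.derivative (hsmooth A hA) ?_ ?_)
    · rcases eq_or_ne R 0 with rfl | h0
      · simp
      · refine (Polynomial.degree_derivative_lt h0).trans_le ?_
        rw [Polynomial.degree_eq_natDegree h0] at hR ⊢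
        have : R.natDegree < n + 1 := Nat.cast_lt.mp hR
        exact Nat.cast_le.mpr (by omega)
    · intro t ht
      have hd : ∀ B : ℝ → ℝ, ContDiffOn ℝ (⊤ : ℕ∞) B (Set.Ioo u v) →
          HasDerivAt B (deriv B t) t := fun B hB =>
        ((hdiff B hB).differentiableAt (isOpen_Ioo.mem_nhds ht)).hasDerivAt
      have hA0 := hd A hA
      have hA1 := hd _ (hsmooth A hA)
      have hA2 := hd _ (hsmooth _ (hsmooth A hA))
      have hy : HasDerivAt (fun t => a + b * t) b t := by
        simpa using ((hasDerivAt_id t).const_mul b).const_add a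
      have hL := (((hy.pow 2).mul hA2).sub (((hy.const_mul (2 * ((n + 1 : ℕ) : ℝ))).mul_const
        b).mul hA1)).add (hA0.const_mul (((n + 1 : ℕ) : ℝ) * ((n + 1 : ℕ) + 1) * b ^ 2))
      have hR' := (R.hasDerivAt t).congr_of_eventuallyEq
        (Filter.eventuallyEq_of_mem (isOpen_Ioo.mem_nhds ht) h)
      have := hL.unique hR'
      rw [← this]
      push_cast
      simp only [Pi.pow_apply]
      ring

lemma esymm_succ_eq {n : ℕ} (x : Fin n → ℝ) (q : Fin n) (r : ℕ) :
    esymm x (r + 1) = esymmHat x q (r + 1) + x q * esymmHat x q r := by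
  unfold esymm esymmHat esymmOn
  conv_lhs => rw [← Finset.insert_erase (Finset.mem_univ q)]
  have hq : q ∉ Finset.univ.erase q := Finset.notMem_erase q _
  have hmem : ∀ s ∈ (Finset.univ.erase q).powersetCard r, q ∉ s := fun s hs hqs =>
    hq ((Finset.mem_powersetCard.mp hs).1 hqs)
  rw [Finset.powersetCard_succ_insert hq, Finset.sum_union, Finset.sum_image, Finset.mul_sum]
  · congr 1
    exact Finset.sum_congr rfl fun s hs => Finset.prod_insert (hmem s hs)
  · intro s hs t ht hst
    rw [← Finset.erase_insert (hmem s hs), ← Finset.erase_insert (hmem t ht), hst]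
  · rw [Finset.disjoint_left]
    intro s hs hs'
    obtain ⟨t, -, rfl⟩ := Finset.mem_image.mp hs'
    exact hq ((Finset.mem_powersetCard.mp hs).1 (Finset.mem_insert_self q t))

lemma esymmHat_update {n : ℕ} (x : Fin n → ℝ) (q : Fin n) (r : ℕ) (t : ℝ) :
    esymmHat (Function.update x q t) q r = esymmHat x q r := by
  unfold esymmHat esymmOn
  refine Finset.sum_congr rfl fun s hs => Finset.prod_congr rfl fun i hi => ?_
  have := (Finset.mem_powersetCard.mp hs).1 hi
  exact Function.update_of_ne (Finset.ne_of_mem_erase this) _ _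

lemma isPolyOn_update {n : ℕ} (S : Set ℝ) (x : Fin n → ℝ) (q i : Fin n) :
    IsPolyOn S 1 fun t => Function.update x q t i := by
  rcases eq_or_ne i q with rfl | h
  · simpa using IsPolyOn.id
  · simpa [Function.update_of_ne h] using IsPolyOn.const (x i)

lemma isPolyOn_esymmOn_update {n : ℕ} (S : Set ℝ) (s : Finset (Fin n)) (x : Fin n → ℝ)
    (q : Fin n) (r : ℕ) : IsPolyOn S 1 fun t => esymmOn s (Function.update x q t) r := by
  refine IsPolyOn.sum _ fun w _ => ?_
  by_cases hq : q ∈ w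
  · refine (IsPolyOn.id.mul (IsPolyOn.const (n := 0) (∏ i ∈ w \ {q}, x i))).congr fun t _ => ?_
    exact Finset.prod_update_of_mem hq x t
  · refine (IsPolyOn.const (∏ i ∈ w, x i)).congr fun t _ => ?_
    exact Finset.prod_update_of_notMem hq x t

lemma Delta_update_self {n : ℕ} (x : Fin n → ℝ) (q : Fin n) (t : ℝ) :
    Delta (Function.update x q t) q = ∏ i ∈ Finset.univ.erase q, (t - x i) :=
  Finset.prod_congr rfl fun i hi => by
    rw [Function.update_self, Function.update_of_ne (Finset.ne_of_mem_erase hi)]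

lemma isPolyOn_Delta_update {n : ℕ} (S : Set ℝ) (x : Fin n → ℝ) (q : Fin n) :
    IsPolyOn S (n - 1) fun t => Delta (Function.update x q t) q := by
  simp only [Delta_update_self]
  refine (IsPolyOn.prod (Finset.univ.erase q) fun i _ =>
    IsPolyOn.id.sub (IsPolyOn.const (x i))).mono ?_
  simp

lemma isPolyOn_Delta_div_Delta {n : ℕ} {S : Set ℝ} (x : Fin n → ℝ) {q s : Fin n} (hsq : s ≠ q)
    (hS : ∀ t ∈ S, t ≠ x s) :
    IsPolyOn S (n - 2) fun t =>
      Delta (Function.update x q t) q / Delta (Function.update x q t) s := by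
  have hpoly : IsPolyOn S (n - 2) fun t => ∏ i ∈ (Finset.univ.erase q).erase s, (t - x i) := by
    refine (IsPolyOn.prod ((Finset.univ.erase q).erase s) fun i _ =>
      IsPolyOn.id.sub (IsPolyOn.const (x i))).mono ?_
    rw [Finset.card_erase_of_mem (by simp [hsq])]
    simp
    omega
  refine (hpoly.const_mul
    (-(∏ i ∈ (Finset.univ.erase s).erase q, (x s - x i))⁻¹)).congr fun t ht => ?_
  have h1 : Delta (Function.update x q t) q
      = (t - x s) * ∏ i ∈ (Finset.univ.erase q).erase s, (t - x i) := by
    rw [Delta_update_self, Finset.mul_prod_erase _ (fun i => t - x i) (by simp [hsq])]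
  have h2 : Delta (Function.update x q t) s
      = (x s - t) * ∏ i ∈ (Finset.univ.erase s).erase q, (x s - x i) := by
    unfold Delta
    rw [← Finset.mul_prod_erase (Finset.univ.erase s) _ (show q ∈ _ by simp [hsq.symm]),
      Function.update_of_ne hsq, Function.update_self]
    congr 1
    refine Finset.prod_congr rfl fun i hi => ?_
    rw [Function.update_of_ne (Finset.ne_of_mem_erase hi)]
  have hne : t - x s ≠ 0 := sub_ne_zero.mpr (hS t ht)
  rw [h1, h2, ← neg_sub t (x s), neg_mul, div_neg, mul_div_mul_left _ _ hne, div_eq_mul_inv]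
  ring

section Line

variable {k : ℕ} {d : Fin k → ℕ}

/-- The point obtained from `y` by replacing its coordinate `(p, q)` by `t`. -/
def lineSV (y : (i : Fin k) → Fin (d i) → ℝ) (p : Fin k) (q : Fin (d p)) (t : ℝ) :
    (i : Fin k) → Fin (d i) → ℝ :=
  Function.update y p (Function.update (y p) q t)

variable (y : (i : Fin k) → Fin (d i) → ℝ) (p : Fin k) (q : Fin (d p))
  (β : (i : Fin k) → Fin (d i) → ℝ)

lemma lineSV_self (t : ℝ) : lineSV y p q t p = Function.update (y p) q t :=
  Function.update_self _ _ _

lemma lineSV_of_ne {i : Fin k} (h : i ≠ p) (t : ℝ) : lineSV y p q t i = y i :=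
  Function.update_of_ne h _ _

lemma lineSV_apply_of_ne {j : (i : Fin k) × Fin (d i)} (h : j ≠ ⟨p, q⟩) (t : ℝ) :
    lineSV y p q t j.1 j.2 = y j.1 j.2 := by
  obtain ⟨i, s⟩ := j
  rcases eq_or_ne i p with rfl | hi
  · have hs : s ≠ q := by
      rintro rfl
      exact h rfl
    rw [lineSV_self, Function.update_of_ne hs]
  · rw [lineSV_of_ne y p q hi]

lemma isPolyOn_esymmOn_lineSV (S : Set ℝ) (i : Fin k) (s : Finset (Fin (d i))) (r : ℕ) :
    IsPolyOn S 1 fun t => esymmOn s (lineSV y p q t i) r := by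
  rcases eq_or_ne i p with rfl | hi
  · simpa only [lineSV_self] using isPolyOn_esymmOn_update S s (y i) q r
  · simpa only [lineSV_of_ne y p q hi] using IsPolyOn.const _

lemma isPolyOn_sum_esymm_lineSV (S : Set ℝ) (β0 : ℝ) :
    IsPolyOn S 1 fun t =>
      β0 + ∑ i : Fin k, ∑ r : Fin (d i), β i r * esymm (lineSV y p q t i) ((r : ℕ) + 1) :=
  (IsPolyOn.const β0).add (IsPolyOn.sum _ fun i _ => IsPolyOn.sum _ fun r _ =>
    (isPolyOn_esymmOn_lineSV y p q S i _ _).const_mul (β i r))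

lemma isPolyOn_PSV_lineSV (S : Set ℝ) (β0 : ℝ) :
    IsPolyOn S 1 fun t => PSV k d β0 β (lineSV y p q t) :=
  isPolyOn_sum_esymm_lineSV y p q β S β0

lemma isPolyOn_dPSV_lineSV (S : Set ℝ) (i : Fin k) (s : Fin (d i)) :
    IsPolyOn S 1 fun t => dPSV k d β (lineSV y p q t) i s :=
  IsPolyOn.sum _ fun r _ => (isPolyOn_esymmOn_lineSV y p q S i _ _).const_mul (β i r)

lemma dPSV_lineSV_self (t : ℝ) :
    dPSV k d β (lineSV y p q t) p q = dPSV k d β y p q := by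
  unfold dPSV
  simp only [lineSV_self, esymmHat_update]

lemma exists_PSV_lineSV_eq (β0 : ℝ) :
    ∃ a : ℝ, ∀ t, PSV k d β0 β (lineSV y p q t) = a + dPSV k d β y p q * t := by
  refine ⟨β0 + ∑ r : Fin (d p), β p r * esymmHat (y p) q ((r : ℕ) + 1)
    + ∑ i ∈ Finset.univ.erase p, fSV k d β y i, fun t => ?_⟩
  have h1 : fSV k d β (lineSV y p q t) p
      = ∑ r : Fin (d p), β p r * esymmHat (y p) q ((r : ℕ) + 1) + dPSV k d β y p q * t := by
    unfold fSV dPSV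
    rw [Finset.sum_mul, ← Finset.sum_add_distrib]
    refine Finset.sum_congr rfl fun r _ => ?_
    rw [lineSV_self, esymm_succ_eq _ q, esymmHat_update, esymmHat_update, Function.update_self]
    ring
  have h2 : ∑ i ∈ Finset.univ.erase p, fSV k d β (lineSV y p q t) i
      = ∑ i ∈ Finset.univ.erase p, fSV k d β y i :=
    Finset.sum_congr rfl fun i hi => by
      unfold fSV
      rw [lineSV_of_ne y p q (Finset.ne_of_mem_erase hi)]
  unfold PSV
  rw [← Finset.add_sum_erase _ _ (Finset.mem_univ p), h1, h2]
  ring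

lemma isPolyOn_Delta_div_Delta_lineSV {S : Set ℝ} (hS : ∀ s, s ≠ q → ∀ t ∈ S, t ≠ y p s)
    {j : (i : Fin k) × Fin (d i)} (hj : j ≠ ⟨p, q⟩) :
    ∃ l : ℕ, l + 2 ≤ ∑ i, d i ∧ IsPolyOn S l fun t =>
      Delta (lineSV y p q t p) q / Delta (lineSV y p q t j.1) j.2 := by
  obtain ⟨i, s⟩ := j
  rcases eq_or_ne i p with rfl | hi
  · have hs : s ≠ q := by
      rintro rfl
      exact hj rfl
    refine ⟨d i - 2, ?_, ?_⟩
    · have h1 : d i ≤ ∑ i, d i := Finset.single_le_sum (fun _ _ => Nat.zero_le _) (Finset.mem_univ i)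
      have h2 := s.isLt
      have h3 := q.isLt
      have h4 : (s : ℕ) ≠ q := fun h => hs (Fin.ext h)
      omega
    · simpa only [lineSV_self] using isPolyOn_Delta_div_Delta (y i) hs (hS s hs)
  · refine ⟨d p - 1, ?_, ?_⟩
    · have h1 : d i + d p ≤ ∑ i, d i := by
        rw [← Finset.sum_pair hi]
        exact Finset.sum_le_sum_of_subset (Finset.subset_univ _)
      have h2 := s.isLt
      have h3 := q.isLt
      omega
    · refine ((isPolyOn_Delta_update S (y p) q).const_mul (Delta (y i) s)⁻¹).congr fun t _ => ?_
      simp only [lineSV_self, lineSV_of_ne y p q hi]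
      ring

end Line

/-- if the family `(A_{ir})` is extremal, then every `A_{pq}` agrees on its
interval `I_{pq}` with a real polynomial of degree at most `m + 2` (the rational-function
denominators prescribed by the product Segre–Veronese factorization structure are trivial). -/
theorem statement8 (k : ℕ) (hk : 1 ≤ k) (d : Fin k → ℕ) (hd : ∀ i, 1 ≤ d i)
    (m : ℕ) (hm : m = ∑ i, d i) (hm2 : 2 ≤ m)
    (β0 : ℝ) (β : (i : Fin k) → Fin (d i) → ℝ)
    (I : (i : Fin k) → Fin (d i) → Set ℝ)
    (hI : ∀ i r, ∃ u v : ℝ, u < v ∧ I i r = Set.Ioo u v)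
    (hdisj : ∀ i, ∀ r s : Fin (d i), r ≠ s → Disjoint (I i r) (I i s))
    (A : (i : Fin k) → Fin (d i) → ℝ → ℝ)
    (hA : ∀ i r, ContDiffOn ℝ (⊤ : ℕ∞) (A i r) (I i r))
    (hP : ∀ x : (i : Fin k) → Fin (d i) → ℝ, (∀ i r, x i r ∈ I i r) →
      PSV k d β0 β x ≠ 0)
    (hext : IsExtremalSV k d m β0 β I A) :
    ∀ (p : Fin k) (q : Fin (d p)), ∃ Υ : Polynomial ℝ, Υ.natDegree ≤ m + 2 ∧
      ∀ x ∈ I p q, A p q x = Υ.eval x := by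
  intro p q
  obtain ⟨α0, α, hE⟩ := hext
  have hpt : ∀ i r, ∃ c, c ∈ I i r := fun i r => by
    obtain ⟨u, v, huv, h⟩ := hI i r
    exact h ▸ Set.nonempty_Ioo.mpr huv
  choose y hy using hpt
  have hline : ∀ t ∈ I p q, ∀ i r, lineSV y p q t i r ∈ I i r := by
    intro t ht i r
    by_cases hj : (⟨i, r⟩ : (i : Fin k) × Fin (d i)) = ⟨p, q⟩
    · cases hj
      simpa [lineSV_self] using ht
    · rw [lineSV_apply_of_ne y p q hj]
      exact hy i r
  have hS : ∀ s, s ≠ q → ∀ t ∈ I p q, t ≠ y p s := by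
    rintro s hs t ht rfl
    exact Set.disjoint_left.mp (hdisj p q s hs.symm) ht (hy p s)
  have hΔ : ∀ t ∈ I p q, Delta (lineSV y p q t p) q ≠ 0 := by
    intro t ht
    rw [lineSV_self, Delta_update_self, Finset.prod_ne_zero_iff]
    exact fun s hs => sub_ne_zero.mpr (hS s (Finset.ne_of_mem_erase hs) t ht)
  let P : ℝ → ℝ := fun t => PSV k d β0 β (lineSV y p q t)
  let T : (i : Fin k) × Fin (d i) → ℝ → ℝ := fun j t =>
    P t ^ 2 * deriv (deriv (A j.1 j.2)) (lineSV y p q t j.1 j.2)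
      - 2 * ((m : ℝ) + 1) * P t * dPSV k d β (lineSV y p q t) j.1 j.2
        * deriv (A j.1 j.2) (lineSV y p q t j.1 j.2)
      + ((m : ℝ) + 1) * ((m : ℝ) + 2) * dPSV k d β (lineSV y p q t) j.1 j.2 ^ 2
        * A j.1 j.2 (lineSV y p q t j.1 j.2)
  have hPpoly : IsPolyOn (I p q) 1 P := isPolyOn_PSV_lineSV y p q β _ β0
  have hT : ∀ j, j ≠ ⟨p, q⟩ → IsPolyOn (I p q) 2 (T j) := by
    intro j hj
    have hd := isPolyOn_dPSV_lineSV y p q β (I p q) j.1 j.2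
    refine ((((hPpoly.mul hPpoly).const_mul (deriv (deriv (A j.1 j.2)) (y j.1 j.2))).sub
      ((hPpoly.mul hd).const_mul (2 * ((m : ℝ) + 1) * deriv (A j.1 j.2) (y j.1 j.2)))).add
      ((hd.mul hd).const_mul (((m : ℝ) + 1) * ((m : ℝ) + 2) * A j.1 j.2 (y j.1 j.2)))).congr
      fun t _ => ?_
    simp only [T, lineSV_apply_of_ne y p q hj]
    ring
  have hdp : d p ≤ m := hm ▸ Finset.single_le_sum (fun _ _ => Nat.zero_le _) (Finset.mem_univ p)
  have hrhs : IsPolyOn (I p q) m fun t => Delta (lineSV y p q t p) q *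
      (α0 + ∑ i : Fin k, ∑ r : Fin (d i), α i r * esymm (lineSV y p q t i) ((r : ℕ) + 1)) := by
    simp only [lineSV_self y p q]
    have := hd p
    exact ((isPolyOn_Delta_update (I p q) (y p) q).mul
      (isPolyOn_sum_esymm_lineSV y p q α (I p q) α0)).mono (by omega)
  have hrest : IsPolyOn (I p q) m fun t => ∑ j ∈ Finset.univ.erase ⟨p, q⟩,
      Delta (lineSV y p q t p) q / Delta (lineSV y p q t j.1) j.2 * T j t := by
    refine IsPolyOn.sum _ fun j hj => ?_
    obtain ⟨l, hl, hpoly⟩ :=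
      isPolyOn_Delta_div_Delta_lineSV y p q hS (Finset.ne_of_mem_erase hj)
    exact (hpoly.mul (hT j (Finset.ne_of_mem_erase hj))).mono (hm ▸ hl)
  have hmain : IsPolyOn (I p q) m (T ⟨p, q⟩) := by
    refine (hrhs.sub hrest).congr fun t ht => ?_
    have hEt := hE (lineSV y p q t) (hline t ht)
    have hsum : ∑ j, T j t / Delta (lineSV y p q t j.1) j.2
        = α0 + ∑ i : Fin k, ∑ r : Fin (d i),
          α i r * esymm (lineSV y p q t i) ((r : ℕ) + 1) := by
      rw [← hEt, Fintype.sum_sigma]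
    rw [← hsum, ← Finset.add_sum_erase _ _ (Finset.mem_univ (⟨p, q⟩ : (i : Fin k) × Fin (d i))),
      mul_add, mul_div_cancel₀ _ (hΔ t ht), Finset.mul_sum, add_sub_assoc,
      ← Finset.sum_sub_distrib, left_eq_add]
    exact Finset.sum_eq_zero fun j _ => by ring
  obtain ⟨u, v, -, hIpq⟩ := hI p q
  obtain ⟨R, hRdeg, hR⟩ := hmain
  obtain ⟨a, ha⟩ := exists_PSV_lineSV_eq y p q β β0
  have hAsmooth := hA p q
  rw [hIpq] at hR hAsmooth hline ⊢
  refine isPolyOn_of_euler_ode (a := a) (b := dPSV k d β y p q) (fun t ht => ?_) (m + 1)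
    (A p q) R hAsmooth ?_ fun t ht => ?_
  · rw [← ha t]
    exact hP _ (hline t ht)
  · exact Polynomial.degree_le_natDegree.trans_lt (Nat.cast_lt.mpr (by omega))
  · rw [← hR t ht]
    simp only [T, P, ha, dPSV_lineSV_self, lineSV_self, Function.update_self]
    push_cast
    ring

end
end
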